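/- arXiv:math/9411218 — 2 statements merged into one kernel-verified Lean document; each statement's English description precedes it below -/
import Mathlib

section
/- There exists a connected finite simple graph with exactly 75198 vertices, maximum degree at most 9, and diameter at most 6. -/
namespace SplitOctonion

variable {F : Type*} [Field F]

/-- Coordinates of Zorn's vector matrices `(a, u; v, b)`, listed as `a, u, v, b`. -/
abbrev Oct (F : Type*) := Fin 8 → F

/-- The product of split octonions in Zorn coordinates. -/
def mulFun (x y : Oct F) : Oct F :=
  ![x 0 * y 0 + (x 1 * y 4 + x 2 * y 5 + x 3 * y 6),
    x 0 * y 1 + y 7 * x 1 - (x 5 * y 6 - x 6 * y 5),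
    x 0 * y 2 + y 7 * x 2 - (x 6 * y 4 - x 4 * y 6),
    x 0 * y 3 + y 7 * x 3 - (x 4 * y 5 - x 5 * y 4),
    y 0 * x 4 + x 7 * y 4 + (x 2 * y 3 - x 3 * y 2),
    y 0 * x 5 + x 7 * y 5 + (x 3 * y 1 - x 1 * y 3),
    y 0 * x 6 + x 7 * y 6 + (x 1 * y 2 - x 2 * y 1),
    x 7 * y 7 + (x 4 * y 1 + x 5 * y 2 + x 6 * y 3)]

theorem mulFun_add_left (x y z : Oct F) : mulFun (x + y) z = mulFun x z + mulFun y z := by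
  ext i; fin_cases i <;> simp [mulFun] <;> ring

theorem mulFun_smul_left (c : F) (x z : Oct F) : mulFun (c • x) z = c • mulFun x z := by
  ext i; fin_cases i <;> simp [mulFun] <;> ring

theorem mulFun_add_right (x y z : Oct F) : mulFun x (y + z) = mulFun x y + mulFun x z := by
  ext i; fin_cases i <;> simp [mulFun] <;> ring

theorem mulFun_smul_right (c : F) (x z : Oct F) : mulFun x (c • z) = c • mulFun x z := by
  ext i; fin_cases i <;> simp [mulFun] <;> ring

/-- The product of split octonions as a bilinear map. -/
def mul : Oct F →ₗ[F] Oct F →ₗ[F] Oct F :=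
  LinearMap.mk₂ F mulFun mulFun_add_left mulFun_smul_left mulFun_add_right mulFun_smul_right

theorem mul_eq (x y : Oct F) : mul x y = mulFun x y := rfl

/-- The trace of a split octonion. -/
def tr : Oct F →ₗ[F] F where
  toFun x := x 0 + x 7
  map_add' x y := by simp only [Pi.add_apply]; ring
  map_smul' c x := by simp only [Pi.smul_apply, smul_eq_mul, RingHom.id_apply]; ring

theorem tr_eq (x : Oct F) : tr x = x 0 + x 7 := rfl

/-- The unit of the split octonions. -/
def unit : Oct F := ![1, 0, 0, 0, 0, 0, 0, 1]

theorem mul_unit (x : Oct F) : mul x unit = x := by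
  ext i; fin_cases i <;> simp [mul_eq, mulFun, unit]

theorem unit_mul (x : Oct F) : mul unit x = x := by
  ext i; fin_cases i <;> simp [mul_eq, mulFun, unit]

theorem apply_seven_of_tr {x : Oct F} (hx : tr x = 0) : x 7 = - x 0 := by
  rw [tr_eq] at hx; linear_combination hx

theorem tr_mul_comm (x y : Oct F) : tr (mul x y) = tr (mul y x) := by
  simp [mul_eq, mulFun, tr_eq]; ring

theorem mul_add_mul_comm {x y : Oct F} (hx : tr x = 0) (hy : tr y = 0) :
    mul x y + mul y x = tr (mul x y) • unit := by
  have h1 := apply_seven_of_tr hx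
  have h2 := apply_seven_of_tr hy
  ext i; fin_cases i <;> simp [mul_eq, mulFun, tr_eq, unit, h1, h2] <;> ring

theorem mul_mul_left_add {x y : Oct F} (hx : tr x = 0) (hy : tr y = 0) (w : Oct F) :
    mul x (mul y w) + mul y (mul x w) = tr (mul x y) • w := by
  have h1 := apply_seven_of_tr hx
  have h2 := apply_seven_of_tr hy
  ext i; fin_cases i <;> simp [mul_eq, mulFun, tr_eq, h1, h2] <;> ring

theorem mul_mul_right_add {x y : Oct F} (hx : tr x = 0) (hy : tr y = 0) (w : Oct F) :
    mul (mul w x) y + mul (mul w y) x = tr (mul x y) • w := by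
  have h1 := apply_seven_of_tr hx
  have h2 := apply_seven_of_tr hy
  ext i; fin_cases i <;> simp [mul_eq, mulFun, tr_eq, h1, h2] <;> ring

theorem left_alternative (x y : Oct F) : mul x (mul x y) = mul (mul x x) y := by
  ext i; fin_cases i <;> simp [mul_eq, mulFun] <;> ring

theorem right_alternative (x y : Oct F) : mul (mul x y) y = mul x (mul y y) := by
  ext i; fin_cases i <;> simp [mul_eq, mulFun] <;> ring

/-- A vector is null if it has trace zero and square zero. -/
def IsNull (x : Oct F) : Prop := tr x = 0 ∧ mul x x = 0

theorem IsNull.coord {x : Oct F} (hx : IsNull x) :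
    x 0 * x 0 + (x 1 * x 4 + x 2 * x 5 + x 3 * x 6) = 0 := by
  have := congrFun hx.2 0
  simpa [mul_eq, mulFun] using this

theorem isNull_of_coord {x : Oct F} (hx : tr x = 0)
    (h : x 0 * x 0 + (x 1 * x 4 + x 2 * x 5 + x 3 * x 6) = 0) : IsNull x := by
  refine ⟨hx, ?_⟩
  have h1 := apply_seven_of_tr hx
  ext i; fin_cases i <;> simp [mul_eq, mulFun, h1] <;> first | ring1 | linear_combination h

/-- The middle Moufang identity for a null vector. -/
theorem IsNull.moufang {r : Oct F} (hr : IsNull r) (y w : Oct F) :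
    mul (mul r y) (mul w r) = tr (mul r (mul y w)) • r := by
  have h1 := apply_seven_of_tr hr.1
  have h2 := hr.coord
  have h3 : mul (mul r y) (mul w r) = tr (mul r (mul y w)) • r +
      (r 0 * r 0 + (r 1 * r 4 + r 2 * r 5 + r 3 * r 6)) •
        (tr (mul y w) • unit - mul y w) := by
    ext i; fin_cases i <;> simp [mul_eq, mulFun, tr_eq, unit, h1] <;> ring
  rw [h3, h2, zero_smul, add_zero]

theorem mul_comm_zero {x y : Oct F} (hx : tr x = 0) (hy : tr y = 0) (h : mul x y = 0) :
    mul y x = 0 := by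
  have := mul_add_mul_comm hx hy
  rwa [h, map_zero, zero_smul, zero_add] at this

/-- Trace-zero vectors annihilated by a common nonzero vector are orthogonal. -/
theorem tr_mul_eq_zero_of_common {r x y : Oct F} (hr : tr r = 0) (hx : tr x = 0) (hy : tr y = 0)
    (hr0 : r ≠ 0) (h1 : mul r x = 0) (h2 : mul r y = 0) : tr (mul x y) = 0 := by
  have e1 := mul_mul_left_add hr hx y
  have e2 := mul_mul_left_add hr hy x
  rw [h1, h2, map_zero, map_zero, add_zero, zero_smul] at e1
  rw [h1, h2, map_zero, map_zero, add_zero, zero_smul] at e2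
  have e3 := congrArg (mul r) (mul_add_mul_comm hx hy)
  rw [map_add, e1, e2, map_smul, mul_unit, add_zero] at e3
  exact (smul_eq_zero.mp e3.symm).resolve_right hr0

theorem IsNull.exists_tr_mul_eq_one {r : Oct F} (hr : IsNull r) (hr0 : r ≠ 0) :
    ∃ t, tr t = 0 ∧ tr (mul r t) = 1 := by
  have key : ∀ t : Oct F, tr t = 0 → tr (mul r t) ≠ 0 → ∃ t, tr t = 0 ∧ tr (mul r t) = 1 :=
    fun t ht h => ⟨(tr (mul r t))⁻¹ • t, by rw [map_smul, ht, smul_zero],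
      by rw [map_smul, map_smul, smul_eq_mul, inv_mul_cancel₀ h]⟩
  by_contra hcon
  have hz : ∀ t : Oct F, tr t = 0 → tr (mul r t) = 0 := fun t ht => by
    by_contra h; exact hcon (key t ht h)
  have h1 := hz ![0, 1, 0, 0, 0, 0, 0, 0] (by simp [tr_eq])
  have h2 := hz ![0, 0, 1, 0, 0, 0, 0, 0] (by simp [tr_eq])
  have h3 := hz ![0, 0, 0, 1, 0, 0, 0, 0] (by simp [tr_eq])
  have h4 := hz ![0, 0, 0, 0, 1, 0, 0, 0] (by simp [tr_eq])
  have h5 := hz ![0, 0, 0, 0, 0, 1, 0, 0] (by simp [tr_eq])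
  have h6 := hz ![0, 0, 0, 0, 0, 0, 1, 0] (by simp [tr_eq])
  simp [tr_eq, mul_eq, mulFun] at h1 h2 h3 h4 h5 h6
  have h0 := hr.coord
  have h7 := apply_seven_of_tr hr.1
  simp [h1, h2, h3] at h0
  apply hr0
  ext i; fin_cases i <;> simp [h0, h1, h2, h3, h4, h5, h6, h7]

/-- The product of two vectors annihilated by a null vector is a multiple of that vector. -/
theorem IsNull.exists_mul_eq_smul {r x z : Oct F} (hr : IsNull r) (hr0 : r ≠ 0)
    (hz : tr z = 0) (h1 : mul r x = 0) (h2 : mul r z = 0) :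
    ∃ c : F, mul x z = c • r := by
  obtain ⟨t, ht, hrt⟩ := hr.exists_tr_mul_eq_one hr0
  have e1 := mul_mul_left_add hr.1 ht x
  rw [h1, map_zero, add_zero, hrt, one_smul] at e1
  have e2 := mul_mul_right_add hr.1 ht z
  rw [mul_comm_zero hr.1 hz h2, LinearMap.map_zero₂, zero_add, hrt, one_smul] at e2
  rw [← e1, ← e2, hr.moufang]
  exact ⟨_, rfl⟩

theorem mem_span_pair_of_triangle {x y z : Oct F} (hx : IsNull x) (hy : IsNull y)
    (hz : IsNull z) (hx0 : x ≠ 0) (hyx : ∀ c : F, y ≠ c • x)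
    (hxy : mul x y = 0) (hxz : mul x z = 0) (hyz : mul y z = 0) :
    ∃ a b : F, z = a • x + b • y := by
  obtain ⟨t, ht, hxt⟩ := hx.exists_tr_mul_eq_one hx0
  have hyx0 := mul_comm_zero hx.1 hy.1 hxy
  have hzx0 := mul_comm_zero hx.1 hz.1 hxz
  set y' := y - tr (mul y t) • x with hy'
  set z' := z - tr (mul z t) • x with hz'
  have ty' : tr y' = 0 := by simp [hy', hx.1, hy.1]
  have tz' : tr z' = 0 := by simp [hz', hx.1, hz.1]
  have ny' : IsNull y' := ⟨ty', by simp [hy', hx.2, hy.2, hxy, hyx0]⟩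
  have y0 : y' ≠ 0 := fun h => hyx _ (sub_eq_zero.mp h)
  have hyz' : mul y' z' = 0 := by simp [hy', hz', hx.2, hyx0, hyz, hxz]
  have hxz' : mul x z' = 0 := by simp [hz', hx.2, hxz]
  have hyt : tr (mul y' t) = 0 := by simp [hy', hxt]
  have hzt : tr (mul z' t) = 0 := by simp [hz', hxt]
  have e1 := mul_mul_left_add ty' ht z'
  rw [hyz', hyt, map_zero, add_zero, zero_smul] at e1
  have e2 := mul_mul_left_add hx.1 ht z'
  rw [hxz', hxt, map_zero, add_zero, one_smul] at e2
  have hw : tr (mul t z') = 0 := by rw [tr_mul_comm, hzt]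
  obtain ⟨c, hc⟩ := ny'.exists_mul_eq_smul y0 (x := x) hw
    (by simp [hy', hyx0, hx.2]) e1
  rw [e2] at hc
  refine ⟨tr (mul z t) - c * tr (mul y t), c, ?_⟩
  calc z = z' + tr (mul z t) • x := by simp [hz']
    _ = _ := by rw [hc, hy']; module

/-- The product of two orthogonal null vectors is a null vector annihilated by both. -/
theorem IsNull.mul_null {p q : Oct F} (hp : IsNull p) (hq : IsNull q) (h : tr (mul p q) = 0) :
    IsNull (mul p q) ∧ mul p (mul p q) = 0 ∧ mul (mul p q) q = 0 := by
  have e := mul_add_mul_comm hp.1 hq.1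
  rw [h, zero_smul] at e
  refine ⟨⟨h, ?_⟩, ?_, ?_⟩
  · have := hp.moufang q q
    rw [hq.2, map_zero, map_zero, zero_smul] at this
    rw [eq_neg_of_add_eq_zero_right e, map_neg, neg_eq_zero] at this
    exact this
  · rw [left_alternative, hp.2, LinearMap.map_zero₂]
  · rw [right_alternative, hq.2, map_zero]

/-- A null vector orthogonal to a null line is annihilated by a vector of that line. -/
theorem exists_mul_eq_zero_of_perp {x p q : Oct F} (hx : IsNull x) (hp : IsNull p)
    (hq : IsNull q) (hp0 : p ≠ 0) (hqp : ∀ c : F, q ≠ c • p) (hpq : mul p q = 0)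
    (h1 : tr (mul x p) = 0) (h2 : tr (mul x q) = 0) :
    ∃ a b : F, a • p + b • q ≠ 0 ∧ mul x (a • p + b • q) = 0 := by
  have hq0 : q ≠ 0 := fun h => hqp 0 (by rw [h, zero_smul])
  have hqp0 := mul_comm_zero hp.1 hq.1 hpq
  by_cases hy0 : mul x p = 0
  · exact ⟨1, 0, by simpa using hp0, by simpa using hy0⟩
  obtain ⟨ny, hy1, hy2⟩ := hx.mul_null hp h1
  obtain ⟨nz, hz1, hz2⟩ := hx.mul_null hq h2
  have hy3 := mul_comm_zero ny.1 hp.1 hy2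
  have hz3 := mul_comm_zero nz.1 hq.1 hz2
  obtain ⟨c, hc⟩ := hp.exists_mul_eq_smul hp0 hq.1 hy3 hpq
  obtain ⟨d, hd⟩ := hq.exists_mul_eq_smul hq0 hp.1 hz3 hqp0
  have e := mul_mul_right_add hp.1 hq.1 x
  rw [hc, hd, hpq, map_zero, zero_smul] at e
  have hd0 : d = 0 := by
    by_contra hd0
    refine hqp (-(d⁻¹ * c)) ?_
    have e' : d • q = -(c • p) := eq_neg_of_add_eq_zero_right e
    have := congrArg (fun v => d⁻¹ • v) e'
    simp only [smul_smul, inv_mul_cancel₀ hd0, one_smul, smul_neg] at this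
    rw [this]; module
  have hc0 : c • p = 0 := by rw [hd0, zero_smul, add_zero] at e; exact e
  rw [hc0] at hc
  obtain ⟨a, b, hab⟩ := mem_span_pair_of_triangle hp hq ny hp0 hqp hpq hy3
    (mul_comm_zero ny.1 hq.1 hc)
  exact ⟨a, b, hab ▸ hy0, hab ▸ hy1⟩

/-- In characteristic two the points between two opposite lines lie on a conic whose nucleus
is spanned by the unit. -/
theorem smul_mul_sub_smul_mul [CharP F 2] {p₁ p₂ q₁ q₂ : Oct F} (hp₁ : IsNull p₁) (hp₂ : IsNull p₂)
    (hq₁ : IsNull q₁) (hq₂ : IsNull q₂) (hp : mul p₁ p₂ = 0) (hq : mul q₁ q₂ = 0)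
    (h₁ : tr (mul p₁ q₁) = 0) (h₂ : tr (mul p₂ q₂) = 0) (ha : tr (mul p₁ q₂) ≠ 0) :
    tr (mul p₁ q₂) • mul p₂ q₁ - tr (mul p₂ q₁) • mul p₁ q₂ =
      (tr (mul p₁ q₂) * tr (mul p₂ q₁)) • unit := by
  have neg : ∀ v : Oct F, -v = v := fun v => by
    ext i; exact CharTwo.neg_eq (v i)
  set a := tr (mul p₁ q₂) with ha'
  set b := tr (mul p₂ q₁) with hb'
  set w := a • mul p₂ q₁ - b • mul p₁ q₂ with hw
  have e1 := mul_mul_right_add hq₁.1 hp₁.1 p₂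
  rw [mul_comm_zero hp₁.1 hp₂.1 hp, tr_mul_comm, h₁, LinearMap.map_zero₂, add_zero, zero_smul] at e1
  have e2 := mul_mul_right_add hq₂.1 hp₁.1 p₁
  rw [hp₁.2, tr_mul_comm, LinearMap.map_zero₂, add_zero, ← ha'] at e2
  have f1 := mul_mul_right_add hp₂.1 hq₂.1 q₁
  rw [hq, h₂, LinearMap.map_zero₂, add_zero, zero_smul] at f1
  have f2 := mul_mul_right_add hp₁.1 hq₂.1 q₂
  rw [hq₂.2, LinearMap.map_zero₂, add_zero, ← ha'] at f2
  have hw1 : mul w p₁ = (a * b) • p₁ := by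
    rw [hw, LinearMap.map_sub₂, LinearMap.map_smul₂, LinearMap.map_smul₂, e1, e2, smul_zero,
      zero_sub, neg, smul_smul, mul_comm a b]
  have hw' : w = b • mul q₂ p₁ - a • mul q₁ p₂ := by
    have g1 := mul_add_mul_comm hp₂.1 hq₁.1
    have g2 := mul_add_mul_comm hp₁.1 hq₂.1
    rw [hw, eq_sub_of_add_eq g1, eq_sub_of_add_eq g2]
    module
  have hw2 : mul w q₂ = (a * b) • q₂ := by
    rw [hw', LinearMap.map_sub₂, LinearMap.map_smul₂, LinearMap.map_smul₂, f1, f2, smul_zero,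
      sub_zero, smul_smul, mul_comm a b]
  have e := mul_mul_right_add hp₁.1 hq₂.1 (w - (a * b) • unit)
  have hd1 : mul (w - (a * b) • unit) p₁ = 0 := by
    rw [LinearMap.map_sub₂, LinearMap.map_smul₂, unit_mul, hw1, sub_self]
  have hd2 : mul (w - (a * b) • unit) q₂ = 0 := by
    rw [LinearMap.map_sub₂, LinearMap.map_smul₂, unit_mul, hw2, sub_self]
  rw [hd1, hd2, LinearMap.map_zero₂, LinearMap.map_zero₂, add_zero] at e
  exact sub_eq_zero.mp ((smul_eq_zero.mp e.symm).resolve_left ha)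

/-- An affine part of an elliptic quadric, lifted to null vectors. -/
def quadricVec (s : F × F) : Oct F :=
  ![s.1 + s.2, 1, s.1, 0, s.1 * s.1 + s.1 * s.2 + s.2 * s.2, s.2, 0, s.1 + s.2]

theorem quadricVec_ne_zero (s : F × F) : quadricVec s ≠ 0 := fun h => by
  simpa [quadricVec] using congrFun h 1

theorem isNull_quadricVec [CharP F 2] (s : F × F) : IsNull (quadricVec s) := by
  have h2 : (2 : F) = 0 := CharTwo.two_eq_zero
  apply isNull_of_coord
  · simp [tr_eq, quadricVec, CharTwo.add_self_eq_zero]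
  · simp [quadricVec]
    linear_combination (s.1 * s.1 + 2 * s.1 * s.2 + s.2 * s.2) * h2

theorem tr_mul_quadricVec [CharP F 2] (s t : F × F) :
    tr (mul (quadricVec s) (quadricVec t)) = (s.1 - t.1) * (s.1 - t.1) +
      (s.1 - t.1) * (s.2 - t.2) + (s.2 - t.2) * (s.2 - t.2) := by
  have h2 : (2 : F) = 0 := CharTwo.two_eq_zero
  simp [tr_eq, mul_eq, mulFun, quadricVec]
  linear_combination
    ((s.1 + s.2) * (t.1 + t.2) + s.2 * t.1 + t.2 * s.1 + s.1 * t.1 + s.2 * t.2) * h2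

/-- A subspace of trace-zero vectors on which the product vanishes. -/
def IsNullSub (W : Submodule F (Oct F)) : Prop :=
  ∀ x ∈ W, tr x = 0 ∧ ∀ y ∈ W, mul x y = 0

variable (F) in
/-- The points of the split Cayley hexagon. -/
def Point := {W : Submodule F (Oct F) // Module.finrank F W = 1 ∧ IsNullSub W}

variable (F) in
/-- The lines of the split Cayley hexagon. -/
def Line := {W : Submodule F (Oct F) // Module.finrank F W = 2 ∧ IsNullSub W}

/-- Incidence of points and lines. -/
def Inc (p : Point F) (l : Line F) : Prop := p.1 ≤ l.1

theorem Point.exists_span (p : Point F) : ∃ x : Oct F, x ≠ 0 ∧ Submodule.span F {x} = p.1 := by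
  obtain ⟨v, hv, h⟩ := finrank_eq_one_iff'.mp p.2.1
  refine ⟨v, fun h0 => hv (Subtype.ext h0), le_antisymm ?_ ?_⟩
  · rw [Submodule.span_singleton_le_iff_mem]; exact v.2
  · intro w hw
    obtain ⟨c, hc⟩ := h ⟨w, hw⟩
    exact Submodule.mem_span_singleton.mpr ⟨c, congrArg Subtype.val hc⟩

/-- A vector spanning a point. -/
noncomputable def Point.rep (p : Point F) : Oct F := p.exists_span.choose

theorem Point.rep_ne_zero (p : Point F) : p.rep ≠ 0 := p.exists_span.choose_spec.1

theorem Point.span_rep (p : Point F) : Submodule.span F {p.rep} = p.1 :=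
  p.exists_span.choose_spec.2

theorem Point.rep_mem (p : Point F) : p.rep ∈ p.1 := by
  rw [← p.span_rep]; exact Submodule.mem_span_singleton_self _

theorem Point.isNull_rep (p : Point F) : IsNull p.rep :=
  ⟨(p.2.2 _ p.rep_mem).1, (p.2.2 _ p.rep_mem).2 _ p.rep_mem⟩

theorem Point.mem_iff (p : Point F) (x : Oct F) : x ∈ p.1 ↔ ∃ c : F, x = c • p.rep := by
  rw [← p.span_rep, Submodule.mem_span_singleton]
  exact exists_congr fun c => eq_comm

theorem Point.eq_of_rep {p q : Point F} {c : F} (h : q.rep = c • p.rep) : p = q := by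
  have hc : c ≠ 0 := fun hc => q.rep_ne_zero (by rw [h, hc, zero_smul])
  apply Subtype.ext
  rw [← p.span_rep, ← q.span_rep, h, Submodule.span_singleton_smul_eq (IsUnit.mk0 c hc)]

theorem Point.rep_ne_smul {p q : Point F} (h : p ≠ q) (c : F) : q.rep ≠ c • p.rep :=
  fun hc => h (Point.eq_of_rep hc)

theorem inc_iff {p : Point F} {l : Line F} : Inc p l ↔ p.rep ∈ l.1 := by
  rw [Inc, ← p.span_rep, Submodule.span_singleton_le_iff_mem]

theorem isNullSub_span_pair {x y : Oct F} (hx : IsNull x) (hy : IsNull y) (h : mul x y = 0) :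
    IsNullSub (Submodule.span F {x, y}) := by
  have h' := mul_comm_zero hx.1 hy.1 h
  intro u hu
  obtain ⟨a, b, rfl⟩ := Submodule.mem_span_pair.mp hu
  refine ⟨by simp [hx.1, hy.1], fun v hv => ?_⟩
  obtain ⟨c, d, rfl⟩ := Submodule.mem_span_pair.mp hv
  simp [hx.2, hy.2, h', h]

/-- The point spanned by a nonzero null vector. -/
def Point.mk (x : Oct F) (hx : IsNull x) (h0 : x ≠ 0) : Point F :=
  ⟨Submodule.span F {x}, finrank_span_singleton h0, by
    simpa using isNullSub_span_pair hx hx hx.2⟩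

theorem Point.rep_mk (x : Oct F) (hx : IsNull x) (h0 : x ≠ 0) :
    ∃ c : F, c ≠ 0 ∧ (Point.mk x hx h0).rep = c • x := by
  obtain ⟨c, hc⟩ := Submodule.mem_span_singleton.mp (Point.mk x hx h0).rep_mem
  exact ⟨c, fun h => (Point.mk x hx h0).rep_ne_zero (by rw [← hc, h, zero_smul]), hc.symm⟩

theorem finrank_span_pair {x y : Oct F} (hx : x ≠ 0) (h : ∀ c : F, y ≠ c • x) :
    Module.finrank F (Submodule.span F {x, y}) = 2 := by
  have hli : LinearIndependent F ![x, y] := by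
    rw [LinearIndependent.pair_iff' hx]
    exact fun c hc => h c hc.symm
  have := finrank_span_eq_card hli
  rwa [Matrix.range_cons_cons_empty, Fintype.card_fin] at this

/-- The line spanned by two independent null vectors with product zero. -/
def Line.mk (x y : Oct F) (hx : IsNull x) (hy : IsNull y) (h0 : x ≠ 0) (hi : ∀ c : F, y ≠ c • x)
    (h : mul x y = 0) : Line F :=
  ⟨Submodule.span F {x, y}, finrank_span_pair h0 hi, isNullSub_span_pair hx hy h⟩

theorem Line.isNull (l : Line F) {x : Oct F} (hx : x ∈ l.1) : IsNull x :=
  ⟨(l.2.2 x hx).1, (l.2.2 x hx).2 x hx⟩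

theorem Line.eq_span (l : Line F) {x y : Oct F} (hx : x ∈ l.1) (hy : y ∈ l.1) (h0 : x ≠ 0)
    (hi : ∀ c : F, y ≠ c • x) : l.1 = Submodule.span F {x, y} := by
  symm
  apply Submodule.eq_of_le_of_finrank_eq
  · rw [Submodule.span_le]; rintro z (rfl | rfl) <;> assumption
  · rw [finrank_span_pair h0 hi, l.2.1]

/-- Points whose representatives have product zero: equal or collinear points. -/
def Coll (p q : Point F) : Prop := mul p.rep q.rep = 0

/-- Orthogonality of points. -/
def Perp (p q : Point F) : Prop := tr (mul p.rep q.rep) = 0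

theorem Coll.symm {p q : Point F} (h : Coll p q) : Coll q p :=
  mul_comm_zero p.isNull_rep.1 q.isNull_rep.1 h

theorem Perp.symm {p q : Point F} (h : Perp p q) : Perp q p := by
  rw [Perp, tr_mul_comm]; exact h

theorem Coll.refl (p : Point F) : Coll p p := p.isNull_rep.2

theorem coll_of_inc {p q : Point F} {l : Line F} (hp : Inc p l) (hq : Inc q l) : Coll p q :=
  (l.2.2 _ (inc_iff.mp hp)).2 _ (inc_iff.mp hq)

theorem Coll.exists_line {p q : Point F} (h : Coll p q) (hne : p ≠ q) :
    ∃ l, Inc p l ∧ Inc q l := by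
  refine ⟨Line.mk p.rep q.rep p.isNull_rep q.isNull_rep p.rep_ne_zero
    (Point.rep_ne_smul hne) h, ?_, ?_⟩ <;> rw [inc_iff] <;>
  exact Submodule.subset_span (by simp)

theorem inc_mk {x : Oct F} {l : Line F} (hx : x ∈ l.1) (h0 : x ≠ 0) :
    Inc (Point.mk x (l.isNull hx) h0) l := by
  rw [Inc]; exact (Submodule.span_singleton_le_iff_mem x l.1).mpr hx

theorem Line.exists_pair (l : Line F) : ∃ x y : Oct F, x ∈ l.1 ∧ y ∈ l.1 ∧ x ≠ 0 ∧
    ∀ c : F, y ≠ c • x := by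
  have : Nontrivial l.1 := Module.nontrivial_of_finrank_pos (R := F) (by rw [l.2.1]; norm_num)
  obtain ⟨x, hx⟩ := exists_ne (0 : l.1)
  by_contra hcon
  push Not at hcon
  have h1 : Module.finrank F l.1 ≤ 1 := finrank_le_one x fun y => by
    obtain ⟨c, hc⟩ := hcon x y x.2 y.2 (fun h => hx (Subtype.ext h))
    exact ⟨c, Subtype.ext hc.symm⟩
  have := l.2.1
  omega

theorem exists_inc_perp (p : Point F) (l : Line F) : ∃ q, Inc q l ∧ Perp p q := by
  obtain ⟨x, y, hx, hy, h0, hi⟩ := l.exists_pair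
  have key : ∀ v ∈ l.1, v ≠ 0 → tr (mul p.rep v) = 0 → ∃ q, Inc q l ∧ Perp p q := by
    intro v hv hv0 h
    refine ⟨Point.mk v (l.isNull hv) hv0, inc_mk hv hv0, ?_⟩
    obtain ⟨c, -, hc⟩ := Point.rep_mk v (l.isNull hv) hv0
    rw [Perp, hc, map_smul, map_smul, h, smul_zero]
  by_cases hα : tr (mul p.rep x) = 0
  · exact key x hx h0 hα
  · refine key (y - (tr (mul p.rep y) * (tr (mul p.rep x))⁻¹) • x)
      (l.1.sub_mem hy (l.1.smul_mem _ hx)) (sub_ne_zero.mpr (hi _)) ?_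
    simp only [map_sub, map_smul, smul_eq_mul]
    field_simp
    ring

theorem Perp.exists_coll {p q : Point F} (h : Perp p q) : ∃ z, Coll p z ∧ Coll z q := by
  by_cases h0 : mul p.rep q.rep = 0
  · exact ⟨p, Coll.refl p, h0⟩
  obtain ⟨h1, h2, h3⟩ := p.isNull_rep.mul_null q.isNull_rep h
  obtain ⟨c, -, hc⟩ := Point.rep_mk _ h1 h0
  refine ⟨Point.mk _ h1 h0, ?_, ?_⟩
  · rw [Coll, hc, map_smul, h2, smul_zero]
  · rw [Coll, hc, LinearMap.map_smul₂, h3, smul_zero]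

theorem perp_of_coll_coll {r p q : Point F} (h1 : Coll r p) (h2 : Coll r q) : Perp p q :=
  tr_mul_eq_zero_of_common r.isNull_rep.1 p.isNull_rep.1 q.isNull_rep.1 r.rep_ne_zero h1 h2

theorem coll_of_quadrangle {p z r s : Point F} (h1 : Coll r p) (h2 : Coll r z) (h3 : Coll s p)
    (h4 : Coll s z) (hne : r ≠ s) : Coll p z := by
  obtain ⟨c, hc⟩ := r.isNull_rep.exists_mul_eq_smul r.rep_ne_zero z.isNull_rep.1 h1 h2
  obtain ⟨d, hd⟩ := s.isNull_rep.exists_mul_eq_smul s.rep_ne_zero z.isNull_rep.1 h3 h4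
  rw [Coll, hd]
  by_cases hd0 : d = 0
  · rw [hd0, zero_smul]
  · refine absurd ?_ (Point.rep_ne_smul hne (d⁻¹ * c))
    rw [mul_smul, ← hc, hd, smul_smul, inv_mul_cancel₀ hd0, one_smul]

theorem inc_of_triangle {z p q : Point F} {l : Line F} (h1 : Coll z p) (h2 : Coll z q)
    (hne : p ≠ q) (hp : Inc p l) (hq : Inc q l) : Inc z l := by
  obtain ⟨a, b, h⟩ := mem_span_pair_of_triangle p.isNull_rep q.isNull_rep z.isNull_rep
    p.rep_ne_zero (Point.rep_ne_smul hne) (coll_of_inc hp hq) h1.symm h2.symm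
  rw [inc_iff, h]
  exact l.1.add_mem (l.1.smul_mem _ (inc_iff.mp hp)) (l.1.smul_mem _ (inc_iff.mp hq))

theorem line_eq {p q : Point F} {l m : Line F} (hne : p ≠ q) (h1 : Inc p l) (h2 : Inc q l)
    (h3 : Inc p m) (h4 : Inc q m) : l = m := by
  apply Subtype.ext
  rw [inc_iff] at *
  rw [l.eq_span h1 h2 p.rep_ne_zero (Point.rep_ne_smul hne),
    m.eq_span h3 h4 p.rep_ne_zero (Point.rep_ne_smul hne)]

theorem perp_of_perp_perp {x p q y : Point F} {l : Line F} (hne : p ≠ q) (hp : Inc p l)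
    (hq : Inc q l) (h1 : Perp x p) (h2 : Perp x q) (hy : Inc y l) : Perp x y := by
  rw [inc_iff] at *
  rw [l.eq_span hp hq p.rep_ne_zero (Point.rep_ne_smul hne), Submodule.mem_span_pair] at hy
  obtain ⟨a, b, h⟩ := hy
  rw [Perp] at *
  rw [← h]
  simp [h1, h2]

theorem exists_coll_of_perp_perp {x p q : Point F} {l : Line F} (hne : p ≠ q) (hp : Inc p l)
    (hq : Inc q l) (h1 : Perp x p) (h2 : Perp x q) : ∃ y, Inc y l ∧ Coll x y := by
  obtain ⟨a, b, h0, h⟩ := exists_mul_eq_zero_of_perp x.isNull_rep p.isNull_rep q.isNull_rep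
    p.rep_ne_zero (Point.rep_ne_smul hne) (coll_of_inc hp hq) h1 h2
  have hv := l.1.add_mem (l.1.smul_mem a (inc_iff.mp hp)) (l.1.smul_mem b (inc_iff.mp hq))
  obtain ⟨c, -, hc⟩ := Point.rep_mk _ (l.isNull hv) h0
  exact ⟨Point.mk _ (l.isNull hv) h0, inc_mk hv h0, by rw [Coll, hc, map_smul, h, smul_zero]⟩

/-- A field with eight elements has no primitive cube roots of unity. -/
theorem anisotropic_of_card_eq_eight [CharP F 2] (hF : Nat.card F = 8) {a b : F}
    (h : a * a + a * b + b * b = 0) : a = 0 ∧ b = 0 := by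
  have : Finite F := Nat.finite_of_card_ne_zero (by rw [hF]; norm_num)
  have := Fintype.ofFinite F
  have hpow : ∀ c : F, c ^ 8 = c := fun c => by
    have := FiniteField.pow_card c
    rwa [← Nat.card_eq_fintype_card, hF] at this
  have h3 : a ^ 3 = b ^ 3 := by linear_combination (a - b) * h
  have h9 : a ^ 9 = b ^ 9 := by linear_combination (a ^ 6 + a ^ 3 * b ^ 3 + b ^ 6) * h3
  have h2 : a ^ 2 = b ^ 2 := by
    linear_combination h9 - a * hpow a + b * hpow b
  have hab : a = b := by
    have : (a - b) ^ 2 = 0 := by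
      rw [CharTwo.sub_eq_add, CharTwo.add_sq, h2, CharTwo.add_self_eq_zero]
    exact sub_eq_zero.mp (pow_eq_zero_iff two_ne_zero |>.mp this)
  subst hab
  have : a * a = 0 := by
    rw [CharTwo.add_self_eq_zero, zero_add] at h; exact h
  have := mul_self_eq_zero.mp this
  exact ⟨this, this⟩

/-- The points of an affine part of an elliptic quadric. -/
def quadricPoint [CharP F 2] (s : F × F) : Point F :=
  Point.mk (quadricVec s) (isNull_quadricVec s) (quadricVec_ne_zero s)

theorem Perp.quadricPoint_eq [CharP F 2] (hF : Nat.card F = 8) {s t : F × F}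
    (h : Perp (quadricPoint s) (quadricPoint t)) : s = t := by
  obtain ⟨c, hc0, hc⟩ := Point.rep_mk _ (isNull_quadricVec s) (quadricVec_ne_zero s)
  obtain ⟨d, hd0, hd⟩ := Point.rep_mk _ (isNull_quadricVec t) (quadricVec_ne_zero t)
  rw [Perp, quadricPoint, quadricPoint, hc, hd, LinearMap.map_smul₂, map_smul, map_smul,
    map_smul] at h
  have h' := ((smul_eq_zero.mp h).resolve_left hc0)
  have h'' := ((smul_eq_zero.mp h').resolve_left hd0)
  rw [tr_mul_quadricVec] at h''
  obtain ⟨h1, h2⟩ := anisotropic_of_card_eq_eight hF h''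
  exact Prod.ext (sub_eq_zero.mp h1) (sub_eq_zero.mp h2)

/-- No conic with nucleus spanned by the unit meets the quadric in three points. -/
theorem quadricVec_conic [CharP F 2] (hF : Nat.card F = 8) {s₁ s₂ s₃ : F × F} {a b e : F}
    (ha : a ≠ 0) (hb : b ≠ 0)
    (h : quadricVec s₃ = a • quadricVec s₁ + b • quadricVec s₂ + e • unit) : s₁ = s₂ := by
  have h2 : (2 : F) = 0 := CharTwo.two_eq_zero
  have e1 := congrFun h 1
  have e2 := congrFun h 2
  have e4 := congrFun h 4
  have e5 := congrFun h 5
  simp [quadricVec, unit] at e1 e2 e4 e5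
  obtain ⟨x₁, y₁⟩ := s₁
  obtain ⟨x₂, y₂⟩ := s₂
  obtain ⟨x₃, y₃⟩ := s₃
  simp only at e2 e4 e5
  subst e2 e5
  have hb' : b = 1 - a := by rw [e1]; ring
  have key : a * b *
      ((x₁ - x₂) * (x₁ - x₂) + (x₁ - x₂) * (y₁ - y₂) + (y₁ - y₂) * (y₁ - y₂)) = 0 := by
    subst hb'
    linear_combination -e4
  obtain ⟨h1, h2⟩ := anisotropic_of_card_eq_eight hF
    ((mul_eq_zero.mp key).resolve_left (mul_ne_zero ha hb))
  exact Prod.ext (sub_eq_zero.mp h1) (sub_eq_zero.mp h2)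

theorem Line.exists_pair_point (l : Line F) : ∃ p q, Inc p l ∧ Inc q l ∧ p ≠ q := by
  obtain ⟨x, y, hx, hy, h0, hi⟩ := l.exists_pair
  have hy0 : y ≠ 0 := fun h => hi 0 (by rw [h, zero_smul])
  refine ⟨_, _, inc_mk hx h0, inc_mk hy hy0, fun h => ?_⟩
  obtain ⟨c, hc⟩ := (Point.mem_iff (Point.mk x (l.isNull hx) h0) y).mp
    (by rw [h]; exact Submodule.mem_span_singleton_self y)
  obtain ⟨d, -, hd⟩ := Point.rep_mk x (l.isNull hx) h0
  exact hi (c * d) (by rw [hc, hd, smul_smul])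

/-- Two lines without collinear points, the first of which misses the quadric, are joined by a path
whose middle point misses the quadric. -/
theorem exists_path_avoiding_quadric [CharP F 2] (hF : Nat.card F = 8) {l m : Line F}
    (hS : ∀ s, ¬ Inc (quadricPoint s) l) (hlm : ∀ p q, Inc p l → Inc q m → ¬ Coll p q) :
    ∃ p q z, Inc p l ∧ Inc q m ∧ Coll p z ∧ Coll z q ∧ ∀ s, z ≠ quadricPoint s := by
  by_contra hcon
  push Not at hcon
  obtain ⟨p₁, p₂, hp₁, hp₂, hp⟩ := l.exists_pair_point
  obtain ⟨q₁, hq₁, h₁⟩ := exists_inc_perp p₁ m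
  obtain ⟨q₂, hq₂, h₂⟩ := exists_inc_perp p₂ m
  have hq : q₁ ≠ q₂ := by
    rintro rfl
    obtain ⟨y, hy, hc⟩ := exists_coll_of_perp_perp hp hp₁ hp₂ h₁.symm h₂.symm
    exact hlm y q₁ hy hq₁ hc.symm
  have ha : tr (mul p₁.rep q₂.rep) ≠ 0 := fun h => by
    obtain ⟨y, hy, hc⟩ := exists_coll_of_perp_perp hp hp₁ hp₂ (Perp.symm h) h₂.symm
    exact hlm y q₂ hy hq₂ hc.symm
  have hb : tr (mul p₂.rep q₁.rep) ≠ 0 := fun h => by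
    obtain ⟨y, hy, hc⟩ := exists_coll_of_perp_perp hp hp₁ hp₂ h₁.symm (Perp.symm h)
    exact hlm y q₁ hy hq₁ hc.symm
  have key : ∀ v ∈ l.1, ∀ w ∈ m.1, v ≠ 0 → w ≠ 0 → tr (mul v w) = 0 →
      ∃ (c : F) (s : F × F), c ≠ 0 ∧ mul v w = c • quadricVec s := by
    intro v hv w hw hv0 hw0 hvw
    obtain ⟨n1, n2, n3⟩ := (l.isNull hv).mul_null (m.isNull hw) hvw
    obtain ⟨a, ha0, ha⟩ := Point.rep_mk v (l.isNull hv) hv0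
    obtain ⟨b, hb0, hb⟩ := Point.rep_mk w (m.isNull hw) hw0
    have hz0 : mul v w ≠ 0 := fun h0 => hlm _ _ (inc_mk hv hv0) (inc_mk hw hw0) (by
      rw [Coll, ha, hb, map_smul, LinearMap.map_smul₂, h0, smul_zero, smul_zero])
    obtain ⟨c, hc0, hc⟩ := Point.rep_mk _ n1 hz0
    obtain ⟨s, hs⟩ := hcon _ _ (Point.mk _ n1 hz0) (inc_mk hv hv0) (inc_mk hw hw0)
      (by rw [Coll, ha, hc, map_smul, LinearMap.map_smul₂, n2, smul_zero, smul_zero])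
      (by rw [Coll, hb, hc, map_smul, LinearMap.map_smul₂, n3, smul_zero, smul_zero])
    obtain ⟨d, hd0, hd⟩ := Point.rep_mk _ (isNull_quadricVec s) (quadricVec_ne_zero s)
    refine ⟨c⁻¹ * d, s, mul_ne_zero (inv_ne_zero hc0) hd0, ?_⟩
    have : c • mul v w = d • quadricVec s := by rw [← hc, ← hd, hs]; rfl
    rw [mul_smul, ← this, smul_smul, inv_mul_cancel₀ hc0, one_smul]
  rw [inc_iff] at hp₁ hp₂ hq₁ hq₂
  obtain ⟨c₁, s₁, hc₁, e₁⟩ := key _ hp₁ _ hq₁ p₁.rep_ne_zero q₁.rep_ne_zero h₁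
  obtain ⟨c₂, s₂, hc₂, e₂⟩ := key _ hp₂ _ hq₂ p₂.rep_ne_zero q₂.rep_ne_zero h₂
  set a := tr (mul p₁.rep q₂.rep)
  set b := tr (mul p₂.rep q₁.rep)
  have hv0 : p₁.rep + p₂.rep ≠ 0 := fun h => Point.rep_ne_smul hp (-1) (by
    rw [neg_one_smul]; exact eq_neg_of_add_eq_zero_right h)
  have hw0 : a • q₁.rep - b • q₂.rep ≠ 0 := fun h => Point.rep_ne_smul hq (b⁻¹ * a) (by
    rw [mul_smul, sub_eq_zero.mp h, smul_smul, inv_mul_cancel₀ hb, one_smul])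
  have conic := smul_mul_sub_smul_mul p₁.isNull_rep p₂.isNull_rep q₁.isNull_rep q₂.isNull_rep
    (coll_of_inc (inc_iff.mpr hp₁) (inc_iff.mpr hp₂))
    (coll_of_inc (inc_iff.mpr hq₁) (inc_iff.mpr hq₂)) h₁ h₂ ha
  have hprod : mul (p₁.rep + p₂.rep) (a • q₁.rep - b • q₂.rep) =
      a • mul p₁.rep q₁.rep - b • mul p₂.rep q₂.rep + (a * b) • unit := by
    rw [← conic]
    simp only [map_sub, map_smul, map_add, LinearMap.add_apply]
    module
  obtain ⟨c₃, s₃, hc₃, e₃⟩ := key _ (l.1.add_mem hp₁ hp₂) _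
    (m.1.sub_mem (m.1.smul_mem a hq₁) (m.1.smul_mem b hq₂)) hv0 hw0 (by
      simp only [map_sub, map_smul, map_add, LinearMap.add_apply, smul_eq_mul]
      rw [show tr (mul p₁.rep q₁.rep) = 0 from h₁, show tr (mul p₂.rep q₂.rep) = 0 from h₂]
      simp only [a, b]
      ring)
  have hs : s₁ = s₂ := by
    refine quadricVec_conic hF (s₃ := s₃) (a := c₃⁻¹ * (a * c₁)) (b := -(c₃⁻¹ * (b * c₂)))
      (e := c₃⁻¹ * (a * b)) (mul_ne_zero (inv_ne_zero hc₃) (mul_ne_zero ha hc₁))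
      (neg_ne_zero.mpr (mul_ne_zero (inv_ne_zero hc₃) (mul_ne_zero hb hc₂))) ?_
    rw [e₃, e₁, e₂] at hprod
    calc quadricVec s₃ = c₃⁻¹ • (c₃ • quadricVec s₃) := by
          rw [smul_smul, inv_mul_cancel₀ hc₃, one_smul]
      _ = _ := by rw [hprod]; module
  subst hs
  refine hS s₁ (inc_of_triangle (p := p₁) (q := p₂) ?_ ?_ hp (inc_iff.mpr hp₁) (inc_iff.mpr hp₂))
  · have := (p₁.isNull_rep.mul_null q₁.isNull_rep h₁).2.1
    obtain ⟨d, -, hd⟩ := Point.rep_mk _ (isNull_quadricVec s₁) (quadricVec_ne_zero s₁)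
    rw [e₁, map_smul] at this
    apply Coll.symm
    rw [Coll, quadricPoint, hd, map_smul, (smul_eq_zero.mp this).resolve_left hc₁, smul_zero]
  · have := (p₂.isNull_rep.mul_null q₂.isNull_rep h₂).2.1
    obtain ⟨d, -, hd⟩ := Point.rep_mk _ (isNull_quadricVec s₁) (quadricVec_ne_zero s₁)
    rw [e₂, map_smul] at this
    apply Coll.symm
    rw [Coll, quadricPoint, hd, map_smul, (smul_eq_zero.mp this).resolve_left hc₂, smul_zero]

theorem mul_self_of_tr_eq_zero {y : Oct F} (hy : tr y = 0) :
    mul y y = (y 0 * y 0 + (y 1 * y 4 + y 2 * y 5 + y 3 * y 6)) • unit := by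
  have := apply_seven_of_tr hy
  ext i; fin_cases i <;> simp [mul_eq, mulFun, unit, this] <;> ring

/-- The trace-zero annihilator of a point. -/
noncomputable def Point.ann (p : Point F) : Submodule F (Oct F) :=
  LinearMap.ker (mul p.rep) ⊓ LinearMap.ker tr

theorem Point.isNull_of_mem_ann {p : Point F} {y : Oct F} (hy : y ∈ p.ann) : IsNull y := by
  obtain ⟨h1, h2⟩ := hy
  rw [SetLike.mem_coe, LinearMap.mem_ker] at h1 h2
  have h := right_alternative p.rep y
  rw [h1, mul_self_of_tr_eq_zero h2, map_smul, mul_unit, LinearMap.map_zero₂] at h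
  refine ⟨h2, ?_⟩
  rw [mul_self_of_tr_eq_zero h2, (smul_eq_zero.mp h.symm).resolve_right p.rep_ne_zero, zero_smul]

theorem Point.finrank_ann (p : Point F) : Module.finrank F p.ann = 3 := by
  obtain ⟨t, ht, ht1⟩ := p.isNull_rep.exists_tr_mul_eq_one p.rep_ne_zero
  have hmul : ∀ y, mul p.rep (mul p.rep y) = 0 := fun y => by
    rw [left_alternative, p.isNull_rep.2, LinearMap.map_zero₂]
  have hker : LinearMap.ker (mul p.rep) = LinearMap.range (mul p.rep) := by
    ext w
    rw [LinearMap.mem_ker, LinearMap.mem_range]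
    constructor
    · intro hw
      have := mul_mul_left_add p.isNull_rep.1 ht w
      rw [hw, map_zero, add_zero, ht1, one_smul] at this
      exact ⟨_, this⟩
    · rintro ⟨y, rfl⟩; exact hmul y
  have h4 : Module.finrank F (LinearMap.ker (mul p.rep)) = 4 := by
    have := LinearMap.finrank_range_add_finrank_ker (mul p.rep)
    rw [← hker, Module.finrank_fin_fun] at this
    omega
  have hsurj : Function.Surjective (tr.domRestrict (LinearMap.ker (mul p.rep))) := fun c =>
    ⟨⟨c • mul p.rep t, by rw [LinearMap.mem_ker, map_smul, hmul, smul_zero]⟩, by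
      simp [LinearMap.domRestrict_apply, ht1]⟩
  have h1 := LinearMap.finrank_range_add_finrank_ker (tr.domRestrict (LinearMap.ker (mul p.rep)))
  rw [LinearMap.range_eq_top.mpr hsurj, finrank_top, Module.finrank_self, h4,
    LinearMap.ker_domRestrict] at h1
  have h2 := (Submodule.equivMapOfInjective _
    (Submodule.injective_subtype (LinearMap.ker (mul p.rep)))
    (Submodule.submoduleOf (LinearMap.ker tr) (LinearMap.ker (mul p.rep)))).finrank_eq
  rw [Submodule.submoduleOf, Submodule.map_comap_subtype] at h2
  rw [Point.ann, ← h2]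
  omega

theorem card_units_eq [Finite F] (hF : Nat.card F = 8) : Nat.card Fˣ = 7 := by
  rw [Nat.card_units, hF]

/-- A set of points is counted by its nonzero vectors. -/
theorem card_points_mul [Finite F] (hF : Nat.card F = 8) (T : Point F → Prop) :
    Nat.card {p // T p} * 7 = Nat.card {x : Oct F // x ≠ 0 ∧ ∃ p, T p ∧ x ∈ p.1} := by
  rw [← card_units_eq hF, ← Nat.card_prod]
  refine Nat.card_congr (Equiv.ofBijective (fun a => ⟨(a.2 : F) • a.1.1.rep,
    smul_ne_zero a.2.ne_zero a.1.1.rep_ne_zero, a.1.1, a.1.2, a.1.1.1.smul_mem _ a.1.1.rep_mem⟩)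
    ⟨?_, ?_⟩)
  · rintro ⟨⟨p, hp⟩, c⟩ ⟨⟨q, hq⟩, d⟩ h
    replace h : (c : F) • p.rep = (d : F) • q.rep := congrArg Subtype.val h
    have : q = p := Point.eq_of_rep (c := (c : F)⁻¹ * d) (by
      rw [mul_smul, ← h, smul_smul, inv_mul_cancel₀ c.ne_zero, one_smul])
    subst this
    have := smul_left_injective F q.rep_ne_zero h
    rw [Units.ext this]
  · rintro ⟨x, hx, p, hp, hxp⟩
    obtain ⟨c, rfl⟩ := (p.mem_iff x).mp hxp
    exact ⟨⟨⟨p, hp⟩, Units.mk0 c fun h => hx (by rw [h, zero_smul])⟩, rfl⟩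

theorem card_nonzero_add_one {P : Oct F → Prop} [Finite F] (h0 : P 0) :
    Nat.card {x : Oct F // x ≠ 0 ∧ P x} + 1 = Nat.card {x // P x} := by
  have h1 : {x : Oct F | P x} = insert 0 {x : Oct F | x ≠ 0 ∧ P x} := by
    ext x
    by_cases hx : x = 0 <;> simp [hx, h0]
  have h2 := Set.ncard_insert_of_notMem (a := (0 : Oct F)) (s := {x : Oct F | x ≠ 0 ∧ P x})
    (by simp)
  rw [← h1] at h2
  exact h2.symm

theorem card_isNull [Finite F] [CharP F 2] : Nat.card {x : Oct F // IsNull x} = Nat.card F ^ 6 := by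
  have := Fintype.ofFinite F
  have h : Nat.card (Fin 6 → F) = Nat.card F ^ 6 := by simp
  rw [← h]
  refine Nat.card_congr (Equiv.ofBijective (fun x => ![x.1 1, x.1 2, x.1 3, x.1 4, x.1 5, x.1 6])
    ⟨?_, ?_⟩)
  · rintro ⟨x, hx⟩ ⟨y, hy⟩ h
    have e1 : x 1 = y 1 := congrFun h 0
    have e2 : x 2 = y 2 := congrFun h 1
    have e3 : x 3 = y 3 := congrFun h 2
    have e4 : x 4 = y 4 := congrFun h 3
    have e5 : x 5 = y 5 := congrFun h 4
    have e6 : x 6 = y 6 := congrFun h 5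
    have hx' := hx.coord
    have hy' := hy.coord
    rw [e1, e2, e3, e4, e5, e6] at hx'
    have e0 : x 0 = y 0 := by
      have : x 0 * x 0 = y 0 * y 0 := by linear_combination hx' - hy'
      rcases mul_self_eq_mul_self_iff.mp this with h | h
      · exact h
      · rw [h, CharTwo.neg_eq]
    have e7 : x 7 = y 7 := by rw [apply_seven_of_tr hx.1, apply_seven_of_tr hy.1, e0]
    apply Subtype.ext
    funext i
    fin_cases i <;> assumption
  · intro u
    obtain ⟨a, ha⟩ := FiniteField.isSquare_of_char_two (F := F) (ringChar.eq F 2)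
      (-(u 0 * u 3 + u 1 * u 4 + u 2 * u 5))
    refine ⟨⟨![a, u 0, u 1, u 2, u 3, u 4, u 5, -a], isNull_of_coord ?_ ?_⟩, ?_⟩
    · simp [tr_eq]
    · simp [← ha]; ring
    · funext i
      fin_cases i <;> rfl

theorem card_point [Finite F] [CharP F 2] (hF : Nat.card F = 8) : Nat.card (Point F) = 37449 := by
  have h1 := card_points_mul hF (fun _ => True)
  have h2 := card_nonzero_add_one (F := F) (P := IsNull) ⟨map_zero _, by simp⟩
  rw [card_isNull, hF] at h2
  have h3 : Nat.card {x : Oct F // x ≠ 0 ∧ ∃ p : Point F, True ∧ x ∈ p.1} =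
      Nat.card {x : Oct F // x ≠ 0 ∧ IsNull x} :=
    Nat.card_congr (Equiv.subtypeEquivRight fun x => and_congr_right fun h0 => by
      constructor
      · rintro ⟨p, -, hp⟩
        exact ⟨(p.2.2 x hp).1, (p.2.2 x hp).2 x hp⟩
      · exact fun hx => ⟨Point.mk x hx h0, trivial, Submodule.mem_span_singleton_self x⟩)
  have h4 : Nat.card {p : Point F // True} = Nat.card (Point F) :=
    Nat.card_congr (Equiv.subtypeUnivEquiv fun _ => trivial)
  rw [h3, h4] at h1
  omega

theorem Line.card_points [Finite F] (hF : Nat.card F = 8) (l : Line F) :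
    Nat.card {p // Inc p l} = 9 := by
  have h1 := card_points_mul hF (fun p => Inc p l)
  have h2 := card_nonzero_add_one (F := F) (P := fun x => x ∈ l.1) l.1.zero_mem
  have h3 : Nat.card {x : Oct F // x ≠ 0 ∧ ∃ p : Point F, Inc p l ∧ x ∈ p.1} =
      Nat.card {x : Oct F // x ≠ 0 ∧ x ∈ l.1} :=
    Nat.card_congr (Equiv.subtypeEquivRight fun x => and_congr_right fun h0 => by
      constructor
      · rintro ⟨p, hpl, hp⟩
        exact hpl hp
      · exact fun hx => ⟨_, inc_mk hx h0, Submodule.mem_span_singleton_self x⟩)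
  have h4 := Module.natCard_eq_pow_finrank (K := F) (V := l.1)
  rw [l.2.1, hF] at h4
  rw [h3] at h1
  change _ + 1 = Nat.card l.1 at h2
  omega

theorem Point.card_coll [Finite F] (hF : Nat.card F = 8) (p : Point F) :
    Nat.card {q // Coll p q} = 73 := by
  have h1 := card_points_mul hF (fun q => Coll p q)
  have h2 := card_nonzero_add_one (F := F) (P := fun x => x ∈ p.ann) p.ann.zero_mem
  have h3 : Nat.card {x : Oct F // x ≠ 0 ∧ ∃ q : Point F, Coll p q ∧ x ∈ q.1} =
      Nat.card {x : Oct F // x ≠ 0 ∧ x ∈ p.ann} :=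
    Nat.card_congr (Equiv.subtypeEquivRight fun x => and_congr_right fun h0 => by
      constructor
      · rintro ⟨q, hpq, hq⟩
        obtain ⟨c, rfl⟩ := (q.mem_iff x).mp hq
        exact p.ann.smul_mem c ⟨hpq, q.isNull_rep.1⟩
      · intro hx
        refine ⟨Point.mk x (Point.isNull_of_mem_ann hx) h0, ?_,
          Submodule.mem_span_singleton_self x⟩
        obtain ⟨c, -, hc⟩ := Point.rep_mk x (Point.isNull_of_mem_ann hx) h0
        rw [Coll, hc, map_smul, LinearMap.mem_ker.mp hx.1, smul_zero])
  have h4 := Module.natCard_eq_pow_finrank (K := F) (V := p.ann)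
  rw [p.finrank_ann, hF] at h4
  rw [h3] at h1
  change _ + 1 = Nat.card p.ann at h2
  omega

theorem finite_submodule [Finite F] : Finite (Submodule F (Oct F)) :=
  Finite.of_injective (fun W => (W : Set (Oct F))) SetLike.coe_injective

instance [Finite F] : Finite (Point F) := by
  have := finite_submodule (F := F)
  unfold Point; infer_instance

instance [Finite F] : Finite (Line F) := by
  have := finite_submodule (F := F)
  unfold Line; infer_instance

theorem card_ne_and {α : Type*} [Finite α] {P : α → Prop} {a : α} (ha : P a) :
    Nat.card {x // x ≠ a ∧ P x} + 1 = Nat.card {x // P x} := by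
  have h1 : {x | P x} = insert a {x | x ≠ a ∧ P x} := by
    ext x
    by_cases hx : x = a <;> simp [hx, ha]
  have h2 := Set.ncard_insert_of_notMem (a := a) (s := {x | x ≠ a ∧ P x}) (by simp)
  rw [← h1] at h2
  exact h2.symm

theorem card_sigma_const {α : Type*} {β : α → Type*} [Finite α] [∀ a, Finite (β a)] {n : ℕ}
    (h : ∀ a, Nat.card (β a) = n) : Nat.card (Σ a, β a) = Nat.card α * n := by
  have := Fintype.ofFinite α
  rw [Nat.card_sigma, Finset.sum_congr rfl fun a _ => h a]
  simp

theorem Point.card_lines [Finite F] (hF : Nat.card F = 8) (p : Point F) :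
    Nat.card {l // Inc p l} = 9 := by
  have h1 := card_ne_and (P := fun q => Coll p q) (Coll.refl p)
  rw [p.card_coll hF] at h1
  have h2 : Nat.card (Σ l : {l // Inc p l}, {q // q ≠ p ∧ Inc q l.1}) =
      Nat.card {l // Inc p l} * 8 := card_sigma_const fun l => by
    have := card_ne_and (P := fun q => Inc q l.1) l.2
    rw [l.1.card_points hF] at this
    omega
  have h3 : Nat.card (Σ l : {l // Inc p l}, {q // q ≠ p ∧ Inc q l.1}) =
      Nat.card {q // q ≠ p ∧ Coll p q} := by
    refine Nat.card_congr (Equiv.ofBijective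
      (fun a => ⟨a.2.1, a.2.2.1, coll_of_inc a.1.2 a.2.2.2⟩) ⟨?_, ?_⟩)
    · rintro ⟨⟨l, hl⟩, q, hq, hql⟩ ⟨⟨m, hm⟩, q', hq', hqm⟩ h
      obtain rfl : q = q' := congrArg Subtype.val h
      obtain rfl := line_eq hq hql hl hqm hm
      rfl
    · rintro ⟨q, hq, hc⟩
      obtain ⟨l, hl, hql⟩ := hc.exists_line hq.symm
      exact ⟨⟨⟨l, hl⟩, q, hq, hql⟩, rfl⟩
  omega

theorem card_line [Finite F] [CharP F 2] (hF : Nat.card F = 8) : Nat.card (Line F) = 37449 := by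
  have h1 : Nat.card (Σ l : Line F, {p // Inc p l}) = Nat.card (Line F) * 9 :=
    card_sigma_const fun l => l.card_points hF
  have h2 : Nat.card (Σ p : Point F, {l // Inc p l}) = Nat.card (Point F) * 9 :=
    card_sigma_const fun p => p.card_lines hF
  rw [card_point hF] at h2
  have h3 : Nat.card (Σ l : Line F, {p // Inc p l}) = Nat.card (Σ p : Point F, {l // Inc p l}) :=
    Nat.card_congr ⟨fun a => ⟨a.2.1, a.1, a.2.2⟩, fun a => ⟨a.2.1, a.1, a.2.2⟩,
      fun _ => rfl, fun _ => rfl⟩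
  omega

/-- Two vertices are joined by a walk of length at most `n`. -/
def Near {V : Type*} (G : SimpleGraph V) (n : ℕ) (a b : V) : Prop := ∃ w : G.Walk a b, w.length ≤ n

section Near

variable {V : Type*} {G : SimpleGraph V} {a b c : V} {n m : ℕ}

theorem Near.mono (h : Near G n a b) (hnm : n ≤ m) : Near G m a b := by
  obtain ⟨w, hw⟩ := h; exact ⟨w, hw.trans hnm⟩

theorem Near.refl (a : V) (n : ℕ) : Near G n a a := ⟨.nil, Nat.zero_le _⟩

theorem Near.symm (h : Near G n a b) : Near G n b a := by
  obtain ⟨w, hw⟩ := h; exact ⟨w.reverse, by rwa [SimpleGraph.Walk.length_reverse]⟩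

theorem Near.trans (h : Near G n a b) (h' : Near G m b c) : Near G (n + m) a c := by
  obtain ⟨w, hw⟩ := h
  obtain ⟨w', hw'⟩ := h'
  exact ⟨w.append w', by rw [SimpleGraph.Walk.length_append]; omega⟩

theorem Near.of_adj (h : G.Adj a b) : Near G 1 a b := ⟨h.toWalk, by simp⟩

/-- Transport of a graph of bounded degree and diameter to a standard vertex set. -/
theorem exists_graph_fin [Finite V] (hV : Nat.card V = n) (hn : n ≠ 0) {d k : ℕ}
    (hd : ∀ v, (G.neighborSet v).ncard ≤ d) (hk : ∀ a b, Near G k a b) :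
    ∃ G' : SimpleGraph (Fin n), G'.Connected ∧ (∀ v, (G'.neighborSet v).ncard ≤ d) ∧
      G'.diam ≤ k := by
  have ε : Fin n ≃ V := (Finite.equivFinOfCardEq hV).symm
  have : Nonempty (Fin n) := ⟨⟨0, Nat.pos_of_ne_zero hn⟩⟩
  have iso : G.comap ε ≃g G := SimpleGraph.Iso.comap ε G
  have hw : ∀ a b, ∃ w : (G.comap ε).Walk a b, w.length ≤ k := fun a b => by
    obtain ⟨w, hw⟩ := hk (iso a) (iso b)
    refine ⟨(w.map iso.symm.toHom).copy (iso.symm_apply_apply a) (iso.symm_apply_apply b), ?_⟩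
    rw [SimpleGraph.Walk.length_copy, SimpleGraph.Walk.length_map]
    exact hw
  refine ⟨G.comap ε, ⟨fun a b => ⟨(hw a b).choose⟩⟩, fun v => ?_, ?_⟩
  · exact (Nat.card_congr (iso.mapNeighborSet v)).trans_le (hd _)
  · obtain ⟨a, b, h⟩ := (G.comap ε).exists_dist_eq_diam
    obtain ⟨w, hw⟩ := hw a b
    rw [← h]
    exact ((G.comap ε).dist_le w).trans hw

end Near

/-- The jumps of the circulant graph on sixty vertices, one for each member of a cluster. -/
def jump : Fin 6 → ZMod 60 := ![1, 2, 3, 11, 19, 26]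

theorem jump_cover : ∀ d : ZMod 60, ∃ i j : Fin 6, ∃ u v : Fin 3,
    d = ![0, jump i, -jump i] u + ![0, jump j, -jump j] v := by
  decide +kernel

variable [CharP F 2]

/-- The data for replacing sixty points of the quadric by clusters: the replaced points and, for
each flag, the member of the cluster that receives the line. -/
structure Gluing (F : Type*) [Field F] [CharP F 2] where
  site : ZMod 60 → Point F
  port : Point F → Line F → Fin 6
  site_mem : ∀ s, ∃ t, site s = quadricPoint t
  site_injective : Function.Injective site
  port_eq_zero : ∀ p l, p ∉ Set.range site → port p l = 0
  exists_port : ∀ s i, ∃ l, Inc (site s) l ∧ port (site s) l = i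
  port_fiber : ∀ s i, {l | Inc (site s) l ∧ port (site s) l = i}.ncard ≤ 2

theorem exists_assignment {α : Type*} (h : Nat.card α = 9) :
    ∃ f : α → Fin 6, ∀ i, (∃ a, f a = i) ∧ {a | f a = i}.ncard ≤ 2 := by
  have : Finite α := Nat.finite_of_card_ne_zero (by omega)
  let ε : α ≃ Fin 9 := Finite.equivFinOfCardEq h
  let r : Fin 9 → Fin 6 := ![0, 1, 2, 3, 4, 5, 0, 1, 2]
  have hr : ∀ i, (∃ k, r k = i) ∧ (Finset.univ.filter fun k => r k = i).card ≤ 2 := by decide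
  refine ⟨fun a => r (ε a), fun i => ⟨?_, ?_⟩⟩
  · obtain ⟨k, hk⟩ := (hr i).1
    exact ⟨ε.symm k, by simpa using hk⟩
  · have h1 : {a | r (ε a) = i}.ncard ≤ {k | r k = i}.ncard :=
      Set.ncard_le_ncard_of_injOn ε (fun a ha => ha) ε.injective.injOn
    have h2 : {k | r k = i}.ncard = (Finset.univ.filter fun k => r k = i).card := by
      rw [← Set.ncard_coe_finset]; simp
    exact h1.trans (h2.trans_le (hr i).2)

theorem exists_gluing (hF : Nat.card F = 8) : Nonempty (Gluing F) := by
  classical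
  have : Finite F := Nat.finite_of_card_ne_zero (by rw [hF]; norm_num)
  have := Fintype.ofFinite F
  have hcard : Fintype.card (ZMod 60) ≤ Fintype.card (F × F) := by
    rw [ZMod.card, ← Nat.card_eq_fintype_card, Nat.card_prod, hF]; norm_num
  obtain ⟨e⟩ := Function.Embedding.nonempty_of_card_le hcard
  choose f hf using fun p : Point F => exists_assignment (p.card_lines hF)
  refine ⟨⟨fun s => quadricPoint (e s), fun p l => if h : (p ∈ Set.range fun s =>
    quadricPoint (e s)) ∧ Inc p l then f p ⟨l, h.2⟩ else 0, fun s => ⟨_, rfl⟩, fun s t h => ?_,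
    fun p l h => ?_, fun s i => ?_, fun s i => ?_⟩⟩
  · apply e.injective
    apply Perp.quadricPoint_eq hF
    replace h : quadricPoint (e s) = quadricPoint (e t) := h
    rw [h]
    exact perp_of_coll_coll (Coll.refl _) (Coll.refl _)
  · exact dif_neg fun h' => h h'.1
  · obtain ⟨l, hl⟩ := (hf (quadricPoint (e s)) i).1
    exact ⟨l.1, l.2, (dif_pos ⟨⟨s, rfl⟩, l.2⟩).trans hl⟩
  · refine le_trans ?_ (hf (quadricPoint (e s)) i).2
    rw [← Set.ncard_image_of_injective _ Subtype.val_injective]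
    refine Set.ncard_le_ncard ?_
    rintro l ⟨hl, h⟩
    rw [dif_pos ⟨⟨s, rfl⟩, hl⟩] at h
    exact ⟨⟨l, hl⟩, h, rfl⟩

namespace Gluing

variable (D : Gluing F)

/-- The points of the glued geometry: a cluster of six copies for each replaced point, and one copy
of every other point. -/
def Copy := {x : Point F × Fin 6 // x.1 ∈ Set.range D.site ∨ x.2 = 0}

/-- The copy of a point that receives a line. -/
def portCopy (p : Point F) (l : Line F) : D.Copy := ⟨(p, D.port p l), by
  by_cases h : p ∈ Set.range D.site
  · exact Or.inl h
  · exact Or.inr (D.port_eq_zero p l h)⟩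

/-- A member of a cluster. -/
def siteCopy (s : ZMod 60) (i : Fin 6) : D.Copy := ⟨(D.site s, i), Or.inl ⟨s, rfl⟩⟩

/-- The oriented edges of the glued graph. -/
def Rel : Line F ⊕ D.Copy → Line F ⊕ D.Copy → Prop
  | .inl l, .inr a => Inc a.1.1 l ∧ a.1.2 = D.port a.1.1 l
  | .inr a, .inr b => a.1.1 = b.1.1 ∨
      ∃ s i, a = D.siteCopy s i ∧ b = D.siteCopy (s + jump i) i
  | _, _ => False

/-- The glued graph. -/
def graph : SimpleGraph (Line F ⊕ D.Copy) := SimpleGraph.fromRel D.Rel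

variable {D}

section Near

open Classical in
variable (D) in
/-- The diameter of the cluster of a point. -/
noncomputable def cost (p : Point F) : ℕ := if p ∈ Set.range D.site then 1 else 0

theorem cost_le (p : Point F) : D.cost p ≤ 1 := by unfold cost; split_ifs <;> omega

theorem mem_of_cost_ne_zero {p : Point F} (h : D.cost p ≠ 0) : p ∈ Set.range D.site := by
  by_contra h'; exact h (if_neg h')

theorem exists_of_cost_ne_zero {p : Point F} (h : D.cost p ≠ 0) : ∃ t, p = quadricPoint t := by
  obtain ⟨s, rfl⟩ := mem_of_cost_ne_zero h
  exact D.site_mem s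

theorem eq_of_quadric (hF : Nat.card F = 8) {p q : Point F} (hp : ∃ t, p = quadricPoint t)
    (hq : ∃ t, q = quadricPoint t) (h : Perp p q) : p = q := by
  obtain ⟨s, rfl⟩ := hp
  obtain ⟨t, rfl⟩ := hq
  rw [Perp.quadricPoint_eq hF h]

theorem cost_add_le (hF : Nat.card F = 8) {p q : Point F} (h : Perp p q) (hne : p ≠ q) :
    D.cost p + D.cost q ≤ 1 := by
  have h1 := D.cost_le p
  have h2 := D.cost_le q
  by_contra hcon
  exact hne (eq_of_quadric hF (exists_of_cost_ne_zero (D := D) (by omega))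
    (exists_of_cost_ne_zero (D := D) (by omega)) h)

theorem near_portCopy {p : Point F} {l : Line F} (h : Inc p l) :
    Near D.graph 1 (.inl l) (.inr (D.portCopy p l)) :=
  Near.of_adj ((SimpleGraph.fromRel_adj _ _ _).mpr ⟨Sum.inl_ne_inr, Or.inl ⟨h, rfl⟩⟩)

theorem near_copy {a b : D.Copy} (h : a.1.1 = b.1.1) :
    Near D.graph (D.cost a.1.1) (.inr a) (.inr b) := by
  by_cases hab : a = b
  · subst hab; exact Near.refl _ _
  have hs : a.1.1 ∈ Set.range D.site := by
    by_contra hs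
    apply hab
    have h1 := a.2.resolve_left hs
    have h2 := b.2.resolve_left (h ▸ hs)
    exact Subtype.ext (Prod.ext h (h1.trans h2.symm))
  rw [cost, if_pos hs]
  exact Near.of_adj ((SimpleGraph.fromRel_adj _ _ _).mpr
    ⟨fun h => hab (Sum.inr_injective h), Or.inl (Or.inl h)⟩)

theorem near_of_coll {a b : D.Copy} (h : Coll a.1.1 b.1.1) (hne : a.1.1 ≠ b.1.1) :
    Near D.graph (D.cost a.1.1 + 2 + D.cost b.1.1) (.inr a) (.inr b) := by
  obtain ⟨l, hp, hq⟩ := h.exists_line hne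
  have h1 := near_copy (D := D) (a := a) (b := D.portCopy a.1.1 l) rfl
  have h2 := near_copy (D := D) (a := b) (b := D.portCopy b.1.1 l) rfl
  exact (h1.trans ((near_portCopy hp).symm.trans ((near_portCopy hq).trans h2.symm))).mono
    (by omega)

theorem near_of_coll_coll {a b : D.Copy} {z : Point F} (h : Coll a.1.1 z) (h' : Coll z b.1.1) :
    Near D.graph (D.cost a.1.1 + D.cost z + D.cost b.1.1 + 4) (.inr a) (.inr b) := by
  by_cases h1 : a.1.1 = z
  · by_cases h2 : z = b.1.1
    · exact (near_copy (h1.trans h2)).mono (by omega)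
    · subst h1
      exact (near_of_coll h' h2).mono (by omega)
  · by_cases h2 : z = b.1.1
    · subst h2
      exact (near_of_coll h h1).mono (by omega)
    · obtain ⟨l, hp, hz⟩ := h.exists_line h1
      obtain ⟨m, hz', hq⟩ := h'.exists_line h2
      have e1 := near_copy (D := D) (a := a) (b := D.portCopy a.1.1 l) rfl
      have e2 := near_copy (D := D) (a := D.portCopy z l) (b := D.portCopy z m) rfl
      have e3 := near_copy (D := D) (a := b) (b := D.portCopy b.1.1 m) rfl
      have e4 := ((near_portCopy (D := D) hp).symm.trans (near_portCopy hz)).trans e2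
      have e5 := ((near_portCopy (D := D) hz').symm.trans (near_portCopy hq)).trans e3.symm
      exact (e1.trans (e4.trans e5)).mono (by change _ + (1 + 1 + D.cost z + _) ≤ _; omega)

theorem near_of_perp (hF : Nat.card F = 8) {a b : D.Copy} (h : Perp a.1.1 b.1.1) :
    Near D.graph 5 (.inr a) (.inr b) := by
  have ha := D.cost_le a.1.1
  have hb := D.cost_le b.1.1
  by_cases h1 : a.1.1 = b.1.1
  · exact (near_copy h1).mono (by omega)
  by_cases h2 : Coll a.1.1 b.1.1
  · exact (near_of_coll h2 h1).mono (by omega)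
  obtain ⟨z, hz, hz'⟩ := h.exists_coll
  have e1 : a.1.1 ≠ z := by rintro rfl; exact h2 hz'
  have e2 : z ≠ b.1.1 := by rintro rfl; exact h2 hz
  have c1 := cost_add_le (D := D) hF h h1
  have c2 := cost_add_le (D := D) hF (perp_of_coll_coll (Coll.refl _) hz) e1
  have c3 := cost_add_le (D := D) hF (perp_of_coll_coll (Coll.refl _) hz') e2
  exact (near_of_coll_coll hz hz').mono (by omega)

theorem near_line_copy (hF : Nat.card F = 8) (l : Line F) (a : D.Copy) :
    Near D.graph 6 (.inl l) (.inr a) := by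
  obtain ⟨q, hq, h⟩ := exists_inc_perp a.1.1 l
  exact ((near_portCopy hq).trans
    (near_of_perp hF (a := D.portCopy q l) (b := a) h.symm)).mono (by omega)

theorem near_jump {a : D.Copy} {s : ZMod 60} (ha : a.1.1 = D.site s) (i : Fin 6) (u : Fin 3) :
    Near D.graph 2 (.inr a) (.inr (D.siteCopy (s + ![0, jump i, -jump i] u) i)) := by
  have h1 : Near D.graph 1 (.inr a) (.inr (D.siteCopy s i)) :=
    (near_copy (b := D.siteCopy s i) ha).mono (cost_le _)
  have hstep : ∀ t, Near D.graph 1 (.inr (D.siteCopy t i)) (.inr (D.siteCopy (t + jump i) i)) := by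
    intro t
    by_cases h : D.siteCopy t i = D.siteCopy (t + jump i) i
    · rw [← h]; exact Near.refl _ _
    · exact Near.of_adj ((SimpleGraph.fromRel_adj _ _ _).mpr
        ⟨fun h' => h (Sum.inr_injective h'), Or.inl (Or.inr ⟨t, i, rfl, rfl⟩)⟩)
  refine Near.trans (n := 1) (m := 1) h1 ?_
  fin_cases u
  · simpa using Near.refl _ _
  · exact hstep s
  · have := (hstep (s - jump i)).symm
    rw [sub_add_cancel] at this
    simpa [sub_eq_add_neg] using this

theorem near_of_sites {a b : D.Copy} (ha : a.1.1 ∈ Set.range D.site)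
    (hb : b.1.1 ∈ Set.range D.site) : Near D.graph 6 (.inr a) (.inr b) := by
  obtain ⟨s, hs⟩ := ha
  obtain ⟨t, ht⟩ := hb
  obtain ⟨i, j, u, v, h⟩ := jump_cover (t - s)
  have h1 := near_jump hs.symm i u
  have h2 := near_jump (D := D) (a := D.siteCopy (s + ![0, jump i, -jump i] u) i) rfl j v
  rw [add_assoc, ← h, add_sub_cancel] at h2
  have h3 := near_copy (D := D) (a := D.siteCopy t j) (b := b) ht
  have := D.cost_le (D.siteCopy t j).1.1
  exact ((h1.trans h2).trans h3).mono (by omega)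

theorem near_of_path {a b : D.Copy} {m : Line F} {r z : Point F} (hp : Inc a.1.1 m)
    (ha : a.1.2 = D.port a.1.1 m) (hr : Inc r m) (h : Coll r z) (h' : Coll z b.1.1)
    (cr : D.cost r = 0) (cz : D.cost z = 0) (cb : D.cost b.1.1 = 0) :
    Near D.graph 6 (.inr a) (.inr b) := by
  have h1 := near_portCopy (D := D) hp
  have h2 : D.portCopy a.1.1 m = a := Subtype.ext (Prod.ext rfl ha.symm)
  rw [h2] at h1
  have h3 := near_of_coll_coll (D := D) (a := D.portCopy r m) (b := b) h h'
  change Near _ (D.cost r + _ + _ + _) _ _ at h3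
  exact (h1.symm.trans ((near_portCopy hr).trans h3)).mono (by omega)

theorem near_of_site (hF : Nat.card F = 8) {a b : D.Copy} (ha : a.1.1 ∈ Set.range D.site)
    (cb : D.cost b.1.1 = 0) (hab : ¬ Perp a.1.1 b.1.1) : Near D.graph 6 (.inr a) (.inr b) := by
  obtain ⟨s, hs⟩ := ha
  obtain ⟨m, hm, hport⟩ := D.exists_port s a.1.2
  rw [hs] at hm hport
  obtain ⟨r, hr, hperp⟩ := exists_inc_perp b.1.1 m
  obtain ⟨z, hz, hz'⟩ := hperp.symm.exists_coll
  have hT : ∃ t, a.1.1 = quadricPoint t := hs ▸ D.site_mem s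
  refine near_of_path hm hport.symm hr hz hz' ?_ ?_ cb
  · by_contra hc
    have := eq_of_quadric hF (exists_of_cost_ne_zero hc) hT
      (perp_of_coll_coll (Coll.refl _) (coll_of_inc hr hm))
    exact hab (this ▸ hperp.symm)
  · by_contra hc
    have := eq_of_quadric hF (exists_of_cost_ne_zero hc) hT
      (perp_of_coll_coll hz (coll_of_inc hr hm))
    exact hab (this ▸ perp_of_coll_coll (Coll.refl _) hz')

theorem exists_three {α : Type*} (h : Nat.card α = 9) :
    ∃ a b c : α, a ≠ b ∧ a ≠ c ∧ b ≠ c := by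
  have : Finite α := Nat.finite_of_card_ne_zero (by omega)
  have := Fintype.ofFinite α
  rw [← Fintype.two_lt_card_iff, ← Nat.card_eq_fintype_card, h]
  norm_num

theorem false_of_cover {α : Type*} (h : Nat.card α = 9) {A B : α → Prop}
    (hc : ∀ x, A x ∨ B x) (hA : ∀ x y, x ≠ y → ¬ (A x ∧ A y))
    (hB : ∀ x y, x ≠ y → ¬ (B x ∧ B y)) : False := by
  obtain ⟨x, y, w, hxy, hxw, hyw⟩ := exists_three h
  have := hA x y hxy
  have := hA x w hxw
  have := hA y w hyw
  have := hB x y hxy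
  have := hB x w hxw
  have := hB y w hyw
  have := hc x
  have := hc y
  have := hc w
  tauto

theorem near_of_not_perp (hF : Nat.card F = 8) {a b : D.Copy} (ca : D.cost a.1.1 = 0)
    (cb : D.cost b.1.1 = 0) (hab : ¬ Perp a.1.1 b.1.1) : Near D.graph 6 (.inr a) (.inr b) := by
  have : Finite F := Nat.finite_of_card_ne_zero (by rw [hF]; norm_num)
  by_contra hcon
  have hport : ∀ m, a.1.2 = D.port a.1.1 m := by
    have hs : a.1.1 ∉ Set.range D.site := fun h => by
      rw [cost, if_pos h] at ca; exact one_ne_zero ca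
    exact fun m => (a.2.resolve_left hs).trans (D.port_eq_zero _ _ hs).symm
  have key : ∀ m : {m // Inc a.1.1 m}, ∃ r z, Inc r m.1 ∧ Perp b.1.1 r ∧ Coll r z ∧
      Coll z b.1.1 ∧ (D.cost r ≠ 0 ∨ D.cost z ≠ 0) := by
    rintro ⟨m, hm⟩
    obtain ⟨r, hr, hperp⟩ := exists_inc_perp b.1.1 m
    obtain ⟨z, hz, hz'⟩ := hperp.symm.exists_coll
    refine ⟨r, z, hr, hperp, hz, hz', ?_⟩
    by_contra hc
    push Not at hc
    exact hcon (near_of_path hm (hport m) hr hz hz' hc.1 hc.2 cb)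
  choose r z hr hperp hz hz' hc using key
  have hra : ∀ m, a.1.1 ≠ r m := fun m h => hab (by rw [h]; exact (hperp m).symm)
  have hinj : ∀ m m', m ≠ m' → r m ≠ r m' := fun m m' hne h =>
    hne (Subtype.ext (line_eq (hra m) m.2 (hr m) m'.2 (h ▸ hr m')))
  have h1 : ∀ m m', m ≠ m' → ¬ (D.cost (r m) ≠ 0 ∧ D.cost (r m') ≠ 0) := fun m m' hne h =>
    hinj m m' hne (eq_of_quadric hF (exists_of_cost_ne_zero h.1) (exists_of_cost_ne_zero h.2)
      (perp_of_coll_coll (coll_of_inc m.2 (hr m)) (coll_of_inc m'.2 (hr m'))))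
  have h2 : ∀ m m', m ≠ m' → ¬ (D.cost (z m) ≠ 0 ∧ D.cost (z m') ≠ 0) := fun m m' hne h => by
    have hzz := eq_of_quadric hF (exists_of_cost_ne_zero h.1) (exists_of_cost_ne_zero h.2)
      (perp_of_coll_coll (hz' m).symm (hz' m').symm)
    have := coll_of_quadrangle (coll_of_inc (hr m) m.2) (hz m) (coll_of_inc (hr m') m'.2)
      (hzz ▸ hz m') (hinj m m' hne)
    exact hab (perp_of_coll_coll this.symm (hz' m))
  exact false_of_cover (a.1.1.card_lines hF) hc h1 h2

theorem near_copy_copy (hF : Nat.card F = 8) (a b : D.Copy) :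
    Near D.graph 6 (.inr a) (.inr b) := by
  by_cases h : Perp a.1.1 b.1.1
  · exact (near_of_perp hF h).mono (by norm_num)
  by_cases ha : D.cost a.1.1 = 0
  · by_cases hb : D.cost b.1.1 = 0
    · exact near_of_not_perp hF ha hb h
    · exact (near_of_site hF (mem_of_cost_ne_zero hb) ha fun h' => h h'.symm).symm
  · by_cases hb : D.cost b.1.1 = 0
    · exact near_of_site hF (mem_of_cost_ne_zero ha) hb h
    · exact near_of_sites (mem_of_cost_ne_zero ha) (mem_of_cost_ne_zero hb)

theorem near_lines {l m : Line F} {p q z : Point F} (hp : Inc p l) (hq : Inc q m)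
    (h : Coll p z) (h' : Coll z q) (cp : D.cost p = 0) (cz : D.cost z = 0) (cq : D.cost q = 0) :
    Near D.graph 6 (.inl l) (.inl m) := by
  have h3 := near_of_coll_coll (D := D) (a := D.portCopy p l) (b := D.portCopy q m) h h'
  change Near _ (D.cost p + D.cost z + D.cost q + 4) _ _ at h3
  exact ((near_portCopy hp).trans (h3.trans (near_portCopy hq).symm)).mono (by omega)

theorem near_lines_of_quadric (hF : Nat.card F = 8) {l m : Line F}
    (hlm : ∀ p q, Inc p l → Inc q m → ¬ Coll p q) {q₀ : Point F} (hq₀ : Inc q₀ m)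
    (hT : ∃ t, q₀ = quadricPoint t) : Near D.graph 6 (.inl l) (.inl m) := by
  have : Finite F := Nat.finite_of_card_ne_zero (by rw [hF]; norm_num)
  have key : ∀ p q, Inc p l → Inc q m → Perp p q → q ≠ q₀ → (¬ ∃ t, p = quadricPoint t) →
      Near D.graph 6 (.inl l) (.inl m) := by
    intro p q hp hq h hne hpT
    obtain ⟨z, hz, hz'⟩ := h.exists_coll
    refine near_lines hp hq hz hz' ?_ ?_ ?_ <;> by_contra hc <;>
      have hc := exists_of_cost_ne_zero hc
    · exact hpT hc
    · have := eq_of_quadric hF hc hT (perp_of_coll_coll hz'.symm (coll_of_inc hq hq₀))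
      exact hlm p q₀ hp hq₀ (this ▸ hz)
    · exact hne (eq_of_quadric hF hc hT (perp_of_coll_coll (Coll.refl _) (coll_of_inc hq hq₀)))
  have hcard := card_ne_and (P := fun q => Inc q m) hq₀
  rw [m.card_points hF] at hcard
  have : Nontrivial {q // q ≠ q₀ ∧ Inc q m} :=
    Finite.one_lt_card_iff_nontrivial.mp (by omega)
  obtain ⟨⟨q₁, hne₁, hq₁⟩, ⟨q₂, hne₂, hq₂⟩, hne⟩ := exists_pair_ne {q // q ≠ q₀ ∧ Inc q m}
  obtain ⟨p₁, hp₁, h₁⟩ := exists_inc_perp q₁ l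
  obtain ⟨p₂, hp₂, h₂⟩ := exists_inc_perp q₂ l
  by_cases hT₁ : ∃ t, p₁ = quadricPoint t
  · by_cases hT₂ : ∃ t, p₂ = quadricPoint t
    · obtain rfl := eq_of_quadric hF hT₁ hT₂
        (perp_of_coll_coll (Coll.refl _) (coll_of_inc hp₁ hp₂))
      have hperp := perp_of_perp_perp (fun h => hne (Subtype.ext h)) hq₁ hq₂ h₁.symm h₂.symm hq₀
      obtain rfl := eq_of_quadric hF hT₁ hT hperp
      exact absurd (Coll.refl _) (hlm _ _ hp₁ hq₀)
    · exact key p₂ q₂ hp₂ hq₂ h₂.symm hne₂ hT₂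
  · exact key p₁ q₁ hp₁ hq₁ h₁.symm hne₁ hT₁

theorem near_line_line (hF : Nat.card F = 8) (l m : Line F) :
    Near D.graph 6 (.inl l) (.inl m) := by
  by_cases hlm : ∀ p q, Inc p l → Inc q m → ¬ Coll p q
  · by_cases hm : ∃ s, Inc (quadricPoint s) m
    · obtain ⟨s, hs⟩ := hm
      exact near_lines_of_quadric hF hlm hs ⟨s, rfl⟩
    by_cases hl : ∃ s, Inc (quadricPoint s) l
    · obtain ⟨s, hs⟩ := hl
      exact (near_lines_of_quadric hF (fun p q hp hq h => hlm q p hq hp h.symm) hs ⟨s, rfl⟩).symm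
    obtain ⟨p, q, z, hp, hq, hz, hz', h⟩ :=
      exists_path_avoiding_quadric hF (fun s hs => hl ⟨s, hs⟩) hlm
    refine near_lines hp hq hz hz' ?_ ?_ ?_ <;> by_contra hc <;>
      obtain ⟨s, rfl⟩ := exists_of_cost_ne_zero hc
    · exact hl ⟨s, hp⟩
    · exact h s rfl
    · exact hm ⟨s, hq⟩
  · push Not at hlm
    obtain ⟨p, q, hp, hq, h⟩ := hlm
    have cp := D.cost_le p
    have cq := D.cost_le q
    have h3 : Near D.graph 4 (.inr (D.portCopy p l)) (.inr (D.portCopy q m)) := by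
      by_cases hne : p = q
      · exact (near_copy (a := D.portCopy p l) (b := D.portCopy q m) hne).mono
          (by change D.cost p ≤ _; omega)
      · exact (near_of_coll (a := D.portCopy p l) (b := D.portCopy q m) h hne).mono
          (by change D.cost p + 2 + D.cost q ≤ _; omega)
    exact ((near_portCopy hp).trans (h3.trans (near_portCopy hq).symm)).mono (by omega)

theorem near_six (hF : Nat.card F = 8) : ∀ a b, Near D.graph 6 a b
  | .inl l, .inl m => near_line_line hF l m
  | .inl l, .inr b => near_line_copy hF l b
  | .inr a, .inl m => (near_line_copy hF m a).symm
  | .inr a, .inr b => near_copy_copy hF a b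

end Near

instance [Finite F] : Finite D.Copy := by unfold Copy; infer_instance

variable (D) in
theorem card_copy [Finite F] (hF : Nat.card F = 8) : Nat.card D.Copy = 37749 := by
  have h0 : (Set.range D.site).ncard = 60 := by
    rw [← Set.image_univ, Set.ncard_image_of_injective _ D.site_injective, Set.ncard_univ,
      Nat.card_zmod]
  have h1 := Set.ncard_add_ncard_compl (Set.range D.site)
  rw [h0, card_point hF] at h1
  have h2 : {x : Point F × Fin 6 | x.1 ∈ Set.range D.site ∨ x.2 = 0} =
      (Set.range D.site) ×ˢ Set.univ ∪ (Set.range D.site)ᶜ ×ˢ {0} := by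
    ext ⟨p, i⟩
    simp only [Set.mem_ofPred_eq, Set.mem_union, Set.mem_prod, Set.mem_univ, and_true,
      Set.mem_compl_iff, Set.mem_singleton_iff]
    tauto
  have h3 : Disjoint ((Set.range D.site) ×ˢ (Set.univ : Set (Fin 6)))
      ((Set.range D.site)ᶜ ×ˢ {0}) :=
    Set.disjoint_prod.mpr (Or.inl disjoint_compl_right)
  have h4 : Nat.card D.Copy = {x : Point F × Fin 6 | x.1 ∈ Set.range D.site ∨ x.2 = 0}.ncard := rfl
  rw [h4, h2, Set.ncard_union_eq h3, Set.ncard_prod, Set.ncard_prod, Set.ncard_univ,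
    Set.ncard_singleton, h0, Nat.card_eq_fintype_card, Fintype.card_fin]
  omega

variable (D) in
theorem ncard_neighborSet_line [Finite F] (hF : Nat.card F = 8) (l : Line F) :
    (D.graph.neighborSet (.inl l)).ncard ≤ 9 := by
  rw [← l.card_points hF]
  change _ ≤ Set.ncard {p | Inc p l}
  refine le_trans (Set.ncard_le_ncard (t := (fun p => Sum.inr (D.portCopy p l)) '' {p | Inc p l})
    ?_) (Set.ncard_image_le (Set.toFinite _))
  rintro (m | a) h
  · simp [graph, Rel] at h
  · obtain ⟨-, h | h⟩ := (SimpleGraph.fromRel_adj _ _ _).mp h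
    · exact ⟨a.1.1, h.1, congrArg Sum.inr (Subtype.ext (Prod.ext rfl h.2.symm))⟩
    · exact h.elim

theorem ncard_neighborSet_copy_of_notMem [Finite F] (hF : Nat.card F = 8) {a : D.Copy}
    (ha : a.1.1 ∉ Set.range D.site) : (D.graph.neighborSet (.inr a)).ncard ≤ 9 := by
  rw [← a.1.1.card_lines hF]
  change _ ≤ Set.ncard {l | Inc a.1.1 l}
  refine le_trans (Set.ncard_le_ncard (t := Sum.inl '' {l | Inc a.1.1 l}) ?_)
    (Set.ncard_image_le (Set.toFinite _))
  have key : ∀ b : D.Copy, a ≠ b → a.1.1 ≠ b.1.1 := fun b hne h =>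
    hne (Subtype.ext (Prod.ext h ((a.2.resolve_left ha).trans (b.2.resolve_left (h ▸ ha)).symm)))
  rintro (m | b) h
  · obtain ⟨-, h | h⟩ := (SimpleGraph.fromRel_adj _ _ _).mp h
    · exact h.elim
    · exact ⟨m, h.1, rfl⟩
  · obtain ⟨hne, (h | ⟨s, i, rfl, -⟩) | (h | ⟨s, i, -, rfl⟩)⟩ :=
      (SimpleGraph.fromRel_adj _ _ _).mp h
    · exact (key b (fun h => hne (congrArg _ h)) h).elim
    · exact (ha ⟨s, rfl⟩).elim
    · exact (key b (fun h => hne (congrArg _ h)) h.symm).elim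
    · exact (ha ⟨_, rfl⟩).elim

variable (D) in
theorem ncard_neighborSet_siteCopy [Finite F] (s : ZMod 60) (i : Fin 6) :
    (D.graph.neighborSet (.inr (D.siteCopy s i))).ncard ≤ 9 := by
  have h1 : (Sum.inl '' {l | Inc (D.site s) l ∧ D.port (D.site s) l = i} :
      Set (Line F ⊕ D.Copy)).ncard ≤ 2 :=
    (Set.ncard_image_le (Set.toFinite _)).trans (D.port_fiber s i)
  have h2 : ((fun j => Sum.inr (D.siteCopy s j)) '' {j | j ≠ i} :
      Set (Line F ⊕ D.Copy)).ncard ≤ 5 := by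
    refine (Set.ncard_image_le (Set.toFinite _)).trans ?_
    have := Set.ncard_add_ncard_compl {i}
    rw [Set.ncard_singleton, Nat.card_eq_fintype_card, Fintype.card_fin] at this
    change Set.ncard {i}ᶜ ≤ 5
    omega
  have h3 : ({Sum.inr (D.siteCopy (s + jump i) i), Sum.inr (D.siteCopy (s - jump i) i)} :
      Set (Line F ⊕ D.Copy)).ncard ≤ 2 :=
    (Set.ncard_insert_le _ _).trans (by rw [Set.ncard_singleton])
  refine le_trans (Set.ncard_le_ncard (t := _ ∪ _ ∪ _) ?_) ((Set.ncard_union_le _ _).trans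
    (add_le_add ((Set.ncard_union_le _ _).trans (add_le_add h1 h2)) h3))
  have hinj : ∀ {t j}, D.siteCopy s i = D.siteCopy t j → s = t ∧ i = j := fun h =>
    ⟨D.site_injective (congrArg (fun x : D.Copy => x.1.1) h), congrArg (fun x : D.Copy => x.1.2) h⟩
  have hcopy : ∀ b : D.Copy, Sum.inr (D.siteCopy s i) ≠ (Sum.inr b : Line F ⊕ D.Copy) →
      D.site s = b.1.1 → (Sum.inr b : Line F ⊕ D.Copy) ∈
        (fun j => Sum.inr (D.siteCopy s j)) '' {j | j ≠ i} := fun b hne h => by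
    have : D.siteCopy s b.1.2 = b := Subtype.ext (Prod.ext h rfl)
    refine ⟨b.1.2, fun hi => hne ?_, congrArg _ this⟩
    rw [← this, ← hi]
  rintro (m | b) h
  · obtain ⟨-, h | h⟩ := (SimpleGraph.fromRel_adj _ _ _).mp h
    · exact h.elim
    · exact Or.inl (Or.inl ⟨m, ⟨h.1, h.2.symm⟩, rfl⟩)
  · obtain ⟨hne, (h | ⟨t, j, hs, rfl⟩) | (h | ⟨t, j, rfl, hs⟩)⟩ :=
      (SimpleGraph.fromRel_adj _ _ _).mp h
    · exact Or.inl (Or.inr (hcopy b hne h))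
    · obtain ⟨rfl, rfl⟩ := hinj hs
      exact Or.inr (Or.inl rfl)
    · exact Or.inl (Or.inr (hcopy b hne h.symm))
    · obtain ⟨rfl, rfl⟩ := hinj hs
      exact Or.inr (Or.inr (by rw [add_sub_cancel_right]; rfl))

variable (D) in
theorem ncard_neighborSet_le [Finite F] (hF : Nat.card F = 8) :
    ∀ v, (D.graph.neighborSet v).ncard ≤ 9
  | .inl l => D.ncard_neighborSet_line hF l
  | .inr a => by
    by_cases ha : a.1.1 ∈ Set.range D.site
    · obtain ⟨s, hs⟩ := ha
      have : a = D.siteCopy s a.1.2 := Subtype.ext (Prod.ext hs.symm rfl)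
      rw [this]
      exact D.ncard_neighborSet_siteCopy s _
    · exact ncard_neighborSet_copy_of_notMem hF ha

end Gluing

end SplitOctonion

/-- There exists a connected finite simple graph with exactly 75198 vertices,
maximum degree at most 9, and diameter at most 6. -/
theorem exists_connected_graph_card_75198_maxDegree_le_9_diam_le_6 :
    ∃ G : SimpleGraph (Fin 75198), G.Connected ∧
      (∀ v : Fin 75198, (G.neighborSet v).ncard ≤ 9) ∧ G.diam ≤ 6 := by
  have hF : Nat.card (GaloisField 2 3) = 8 := GaloisField.card 2 3 (by norm_num)
  have : Finite (GaloisField 2 3) := Nat.finite_of_card_ne_zero (by rw [hF]; norm_num)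
  obtain ⟨D⟩ := SplitOctonion.exists_gluing hF
  have hcard : Nat.card (SplitOctonion.Line (GaloisField 2 3) ⊕ D.Copy) = 75198 := by
    rw [Nat.card_sum, SplitOctonion.card_line hF, D.card_copy hF]
  exact SplitOctonion.exists_graph_fin hcard (by norm_num) (D.ncard_neighborSet_le hF)
    (SplitOctonion.Gluing.near_six hF)
end

section
/- There exists a connected finite simple graph with exactly 133500 vertices, maximum degree at most 10, and diameter at most 6. -/
namespace ModifiedHexagon

/-- Supervertices of the core: a side and a point of a `9 × 9` grid. -/
abbrev Super : Type := Bool × Fin 9 × Fin 9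

/-- The number of vertices in the clique replacing a supervertex. -/
def cliqueSize (x : Super) : ℕ := if x.2.1 < 2 ∧ x.2.2 < 3 then 6 else 5

theorem cliqueSize_pos (x : Super) : 0 < cliqueSize x := by
  unfold cliqueSize; split_ifs <;> norm_num

/-- The vertices: core vertices, and on either side three outer levels with coordinates in `F`. -/
inductive Vertex (F : Type) : Type
  | core (x : Super) (c : Fin (cliqueSize x)) : Vertex F
  | lev3 (s : Bool) (a₁ a₂ a₃ : F) : Vertex F
  | lev4 (s : Bool) (a₁ a₂ a₃ a₄ : F) : Vertex F
  | lev5 (s : Bool) (a₁ a₂ a₃ a₄ a₅ : F) : Vertex F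

open Vertex

/-- Shifts defining the five edges from a supervertex to the opposite side. -/
def shift : ℕ → Fin 9 × Fin 9
  | 0 => (0, 0)
  | 1 => (5, 1)
  | 2 => (7, 4)
  | 3 => (2, 3)
  | _ => (4, 6)

/-- The supervertex on the opposite side reached through the cross edge with label `c`. -/
def cross (c : ℕ) : Super → Super
  | (false, i, j) => (true, i + j + (shift c).1, i - j + (shift c).2)
  | (true, i, j) =>
    (false, 5 * ((i - (shift c).1) + (j - (shift c).2)),
      5 * ((i - (shift c).1) - (j - (shift c).2)))

/-- The neighbour of a supervertex through the slot `9 + t`. -/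
def next (x : Super) (t : Fin 21) : Super :=
  if t.val < 8 then (x.1, x.2.1 + Fin.ofNat 9 (t.val + 1), x.2.2)
  else if t.val < 16 then (x.1, x.2.1, x.2.2 + Fin.ofNat 9 (t.val - 7))
  else cross (t.val - 16) x

/-- The slot of the reverse of an edge. -/
def rev (t : Fin 21) : Fin 21 :=
  if t.val < 8 then Fin.ofNat 21 (7 - t.val)
  else if t.val < 16 then Fin.ofNat 21 (23 - t.val)
  else t

theorem rev_rev (t : Fin 21) : rev (rev t) = t := by
  revert t; decide

theorem next_next_rev (x : Super) (t : Fin 21) : next (next x t) (rev t) = x := by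
  obtain ⟨s, i, j⟩ := x
  revert s i j t
  decide +kernel

theorem exists_next_eq_fst (s : Bool) (i i' j : Fin 9) (h : i ≠ i') :
    ∃ t, next (s, i, j) t = (s, i', j) := by
  revert s i i' j
  decide +kernel

theorem exists_next_eq_snd (s : Bool) (i j j' : Fin 9) (h : j ≠ j') :
    ∃ t, next (s, i, j) t = (s, i, j') := by
  revert s i j j'
  decide +kernel

theorem exists_cross_aligned (i j i' j' : Fin 9) :
    ∃ c : Fin 5, (cross c (false, i, j)).2.1 = i' ∨ (cross c (false, i, j)).2.2 = j' ∨
      (cross c (true, i', j')).2.1 = i ∨ (cross c (true, i', j')).2.2 = j := by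
  revert i j i' j'
  decide +kernel

/-- Two supervertices are equal, adjacent, or have a common neighbour. -/
def SuperClose (x y : Super) : Prop :=
  x = y ∨ (∃ t, next x t = y) ∨ ∃ t t', next (next x t) t' = y

theorem SuperClose.symm {x y : Super} (h : SuperClose x y) : SuperClose y x := by
  rcases h with h | ⟨t, h⟩ | ⟨t, t', h⟩
  · exact .inl h.symm
  · exact .inr (.inl ⟨rev t, by rw [← h, next_next_rev]⟩)
  · exact .inr (.inr ⟨rev t', rev t, by rw [← h, next_next_rev, next_next_rev]⟩)

theorem superClose_of_aligned {x z y : Super} {t : Fin 21} (h : next x t = z) (hs : z.1 = y.1)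
    (ha : z.2.1 = y.2.1 ∨ z.2.2 = y.2.2) : SuperClose x y := by
  obtain ⟨s, i, j⟩ := z
  obtain ⟨s', i', j'⟩ := y
  simp only at hs ha
  subst hs
  by_cases hi : i = i'
  · by_cases hj : j = j'
    · exact .inr (.inl ⟨t, by rw [h, hi, hj]⟩)
    · obtain ⟨t', h'⟩ := exists_next_eq_snd s i j j' hj
      exact .inr (.inr ⟨t, t', by rw [h, h', hi]⟩)
  · obtain ⟨t', h'⟩ := exists_next_eq_fst s i i' j hi
    exact .inr (.inr ⟨t, t', by rw [h, h', ha.resolve_left hi]⟩)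

theorem exists_next_eq_cross (c : Fin 5) (x : Super) : ∃ t, next x t = cross c x := by
  refine ⟨⟨16 + c, by omega⟩, ?_⟩
  have h8 : ¬ 16 + (c : ℕ) < 8 := by omega
  have h16 : ¬ 16 + (c : ℕ) < 16 := by omega
  simp [next, h8, h16]

theorem superClose_opposite (i j i' j' : Fin 9) :
    SuperClose (false, i, j) (true, i', j') := by
  obtain ⟨c, h⟩ := exists_cross_aligned i j i' j'
  rw [← or_assoc] at h
  rcases h with h | h
  · obtain ⟨t, ht⟩ := exists_next_eq_cross c (false, i, j)
    exact superClose_of_aligned ht rfl h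
  · obtain ⟨t, ht⟩ := exists_next_eq_cross c (true, i', j')
    exact (superClose_of_aligned (y := (false, i, j)) ht rfl h).symm

theorem superClose_same (s : Bool) (i j i' j' : Fin 9) :
    SuperClose (s, i, j) (s, i', j') := by
  by_cases hi : i = i'
  · by_cases hj : j = j'
    · exact .inl (by rw [hi, hj])
    · obtain ⟨t, h⟩ := exists_next_eq_snd s i j j' hj
      exact .inr (.inl ⟨t, by rw [h, hi]⟩)
  · obtain ⟨t, h⟩ := exists_next_eq_fst s i i' j hi
    exact superClose_of_aligned h rfl (.inl rfl)

theorem superClose (x y : Super) : SuperClose x y := by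
  obtain ⟨s, i, j⟩ := x
  obtain ⟨s', i', j'⟩ := y
  cases s <;> cases s'
  · exact superClose_same _ _ _ _ _
  · exact superClose_opposite _ _ _ _
  · exact (superClose_opposite _ _ _ _).symm
  · exact superClose_same _ _ _ _ _

/-- The core vertex over `x` that carries slot `t`. -/
def port (F : Type) (x : Super) (t : ℕ) : Vertex F :=
  core x ⟨t % cliqueSize x, Nat.mod_lt _ (cliqueSize_pos x)⟩

/-- Incidence of the points and lines opposite to a fixed flag of the split Cayley hexagon. -/
def Incident {F : Type} [Field F] (a₁ a₂ a₃ a₄ a₅ k₁ k₂ k₃ k₄ k₅ : F) : Prop :=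
  k₂ = a₅ - k₁ * a₁ ∧ k₃ = k₁ ^ 2 * a₁ ^ 3 + a₄ - k₁ * a₂ ∧
    k₄ = k₁ * a₁ ^ 2 + a₃ + a₁ * a₅ ∧ k₅ = k₁ * a₁ ^ 3 + a₂

/-- The edges of the graph, each with one of its directions. -/
inductive Arc {F : Type} [Field F] (e : F ≃ Fin 9) : Vertex F → Vertex F → Prop
  | clique (x c c') : Arc e (core x c) (core x c')
  | link (x) (t : Fin 21) : Arc e (port F x (9 + t)) (port F (next x t) (9 + rev t))
  | attach (s a₁ a₂ a₃) : Arc e (port F (s, e a₁, e a₂) (e a₃)) (lev3 s a₁ a₂ a₃)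
  | child3 (s a₁ a₂ a₃ a₄) : Arc e (lev3 s a₁ a₂ a₃) (lev4 s a₁ a₂ a₃ a₄)
  | child4 (s a₁ a₂ a₃ a₄ a₅) : Arc e (lev4 s a₁ a₂ a₃ a₄) (lev5 s a₁ a₂ a₃ a₄ a₅)
  | incident (a₁ a₂ a₃ a₄ a₅ k₁ k₂ k₃ k₄ k₅) (h : Incident a₁ a₂ a₃ a₄ a₅ k₁ k₂ k₃ k₄ k₅) :
      Arc e (lev5 false a₁ a₂ a₃ a₄ a₅) (lev5 true k₁ k₂ k₃ k₄ k₅)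

/-- The split Cayley hexagon over `F` with the vertices near a flag replaced by cliques. -/
def graph {F : Type} [Field F] (e : F ≃ Fin 9) : SimpleGraph (Vertex F) :=
  SimpleGraph.fromRel (Arc e)

/-- The vertices `u` and `v` are joined by a walk of length at most `n`. -/
def Near {V : Type} (G : SimpleGraph V) (n : ℕ) (u v : V) : Prop :=
  ∃ p : G.Walk u v, p.length ≤ n

namespace Near

variable {V : Type} {G : SimpleGraph V} {u v w : V} {m n : ℕ}

theorem refl : Near G 0 u u := ⟨.nil, le_rfl⟩

theorem mono (h : Near G m u v) (hmn : m ≤ n) : Near G n u v :=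
  h.imp fun _ hp ↦ hp.trans hmn

theorem symm (h : Near G n u v) : Near G n v u := by
  obtain ⟨p, hp⟩ := h
  exact ⟨p.reverse, by simpa using hp⟩

theorem trans (h : Near G m u v) (h' : Near G n v w) : Near G (m + n) u w := by
  obtain ⟨p, hp⟩ := h
  obtain ⟨q, hq⟩ := h'
  exact ⟨p.append q, by rw [SimpleGraph.Walk.length_append]; omega⟩

theorem cons (h : Near G 1 u v) (h' : Near G n v w) : Near G (n + 1) u w := by
  rw [add_comm]; exact h.trans h'

end Near

section Paths

variable {F : Type} [Field F] (e : F ≃ Fin 9)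

theorem near_of_arc {u v : Vertex F} (h : Arc e u v) : Near (graph e) 1 u v := by
  by_cases huv : u = v
  · subst huv; exact Near.refl.mono zero_le_one
  · have : (graph e).Adj u v := (SimpleGraph.fromRel_adj _ _ _).2 ⟨huv, .inl h⟩
    exact ⟨this.toWalk, by simp⟩

theorem near_clique (x c c') : Near (graph e) 1 (core x c) (core x c') :=
  near_of_arc e (.clique x c c')

theorem near_of_next {x y : Super} {t} (h : next x t = y) (c c') :
    Near (graph e) 3 (core x c) (core y c') := by
  subst h
  exact .cons (near_clique e x c _) (.cons (near_of_arc e (.link x t)) (near_clique e _ _ c'))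

theorem near_core (x y c c') : Near (graph e) 5 (core x c) (core y c') := by
  rcases superClose x y with h | ⟨t, h⟩ | ⟨t, t', h⟩
  · subst h; exact (near_clique e x c c').mono (by norm_num)
  · exact (near_of_next e h c c').mono (by norm_num)
  · subst h
    exact .cons (near_clique e x c _) (.cons (near_of_arc e (.link x t))
      (near_of_next e rfl _ c'))

theorem near_core_of_fst_eq (s i j j' c c') :
    Near (graph e) 3 (core (s, i, j) c) (core (s, i, j') c') := by
  by_cases hj : j = j'
  · subst hj; exact (near_clique e _ c c').mono (by norm_num)
  · obtain ⟨t, h⟩ := exists_next_eq_snd s i j j' hj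
    exact near_of_next e h c c'

theorem near_attach (s) (a₁ a₂ a₃ : F) :
    Near (graph e) 1 (port F (s, e a₁, e a₂) (e a₃)) (lev3 s a₁ a₂ a₃) :=
  near_of_arc e (.attach ..)

theorem exists_near_lev3 (s) (a₁ a₂ : F) (c) :
    ∃ a₃, Near (graph e) 1 (core (s, e a₁, e a₂) c) (lev3 s a₁ a₂ a₃) := by
  have hc : (c : ℕ) < 9 := c.2.trans_le (by unfold cliqueSize; split_ifs <;> norm_num)
  refine ⟨e.symm ⟨c, hc⟩, ?_⟩
  have := near_attach e s a₁ a₂ (e.symm ⟨c, hc⟩)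
  simpa [port, Nat.mod_eq_of_lt c.2] using this

theorem near_core_lev3 (s) (a₁ a₂ a₃ : F) (c) :
    Near (graph e) 2 (core (s, e a₁, e a₂) c) (lev3 s a₁ a₂ a₃) :=
  .cons (near_clique e _ c _) (near_attach e s a₁ a₂ a₃)

theorem near_child3 (s) (a₁ a₂ a₃ a₄ : F) :
    Near (graph e) 1 (lev3 s a₁ a₂ a₃) (lev4 s a₁ a₂ a₃ a₄) :=
  near_of_arc e (.child3 ..)

theorem near_child4 (s) (a₁ a₂ a₃ a₄ a₅ : F) :
    Near (graph e) 1 (lev4 s a₁ a₂ a₃ a₄) (lev5 s a₁ a₂ a₃ a₄ a₅) :=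
  near_of_arc e (.child4 ..)

theorem near_parent4 (s) (a₁ a₂ a₃ a₄ : F) :
    Near (graph e) 1 (lev4 s a₁ a₂ a₃ a₄) (lev3 s a₁ a₂ a₃) :=
  (near_child3 e s a₁ a₂ a₃ a₄).symm

theorem near_parent5 (s) (a₁ a₂ a₃ a₄ a₅ : F) :
    Near (graph e) 1 (lev5 s a₁ a₂ a₃ a₄ a₅) (lev4 s a₁ a₂ a₃ a₄) :=
  (near_child4 e s a₁ a₂ a₃ a₄ a₅).symm

variable {e} in
theorem near_incident {a₁ a₂ a₃ a₄ a₅ k₁ k₂ k₃ k₄ k₅ : F}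
    (h : Incident a₁ a₂ a₃ a₄ a₅ k₁ k₂ k₃ k₄ k₅) :
    Near (graph e) 1 (lev5 false a₁ a₂ a₃ a₄ a₅) (lev5 true k₁ k₂ k₃ k₄ k₅) :=
  near_of_arc e (.incident _ _ _ _ _ _ _ _ _ _ h)

theorem incident_right (k₁ a₁ a₂ a₃ a₄ a₅ : F) :
    Incident a₁ a₂ a₃ a₄ a₅ k₁ (a₅ - k₁ * a₁) (k₁ ^ 2 * a₁ ^ 3 + a₄ - k₁ * a₂)
      (k₁ * a₁ ^ 2 + a₃ + a₁ * a₅) (k₁ * a₁ ^ 3 + a₂) :=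
  ⟨rfl, rfl, rfl, rfl⟩

theorem incident_left (a₁ k₁ k₂ k₃ k₄ k₅ : F) :
    Incident a₁ (k₅ - k₁ * a₁ ^ 3) (k₄ - k₁ * a₁ ^ 2 - a₁ * (k₂ + k₁ * a₁))
      (k₃ - k₁ ^ 2 * a₁ ^ 3 + k₁ * (k₅ - k₁ * a₁ ^ 3)) (k₂ + k₁ * a₁) k₁ k₂ k₃ k₄ k₅ := by
  refine ⟨?_, ?_, ?_, ?_⟩ <;> ring

/-- From a point to the line through it with first coordinate `k₁`. -/
theorem near_right (k₁ a₁ a₂ a₃ a₄ a₅ : F) :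
    Near (graph e) 1 (lev5 false a₁ a₂ a₃ a₄ a₅)
      (lev5 true k₁ (a₅ - k₁ * a₁) (k₁ ^ 2 * a₁ ^ 3 + a₄ - k₁ * a₂)
        (k₁ * a₁ ^ 2 + a₃ + a₁ * a₅) (k₁ * a₁ ^ 3 + a₂)) :=
  near_incident (incident_right ..)

/-- From a line to the point on it with first coordinate `a₁`. -/
theorem near_left (a₁ k₁ k₂ k₃ k₄ k₅ : F) :
    Near (graph e) 1 (lev5 true k₁ k₂ k₃ k₄ k₅)
      (lev5 false a₁ (k₅ - k₁ * a₁ ^ 3) (k₄ - k₁ * a₁ ^ 2 - a₁ * (k₂ + k₁ * a₁))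
        (k₃ - k₁ ^ 2 * a₁ ^ 3 + k₁ * (k₅ - k₁ * a₁ ^ 3)) (k₂ + k₁ * a₁)) :=
  (near_incident (incident_left ..)).symm

theorem exists_incident_left (a₁ a₂ k₁ k₂ k₃ k₄ k₅ : F) (h : k₅ = k₁ * a₁ ^ 3 + a₂) :
    ∃ a₃ a₄ a₅, Incident a₁ a₂ a₃ a₄ a₅ k₁ k₂ k₃ k₄ k₅ := by
  refine ⟨k₄ - k₁ * a₁ ^ 2 - a₁ * (k₂ + k₁ * a₁), k₃ - k₁ ^ 2 * a₁ ^ 3 + k₁ * a₂,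
    k₂ + k₁ * a₁, ?_, ?_, ?_, h⟩ <;> ring

theorem exists_incident_right (a₁ a₂ a₃ a₄ a₅ k₁ k₂ : F) (h : k₂ = a₅ - k₁ * a₁) :
    ∃ k₃ k₄ k₅, Incident a₁ a₂ a₃ a₄ a₅ k₁ k₂ k₃ k₄ k₅ :=
  ⟨_, _, _, h, rfl, rfl, rfl⟩

variable [CharP F 3]

section Coordinates

variable {a₁ a₂ a₃ a₄ a₅ k₁ k₂ k₃ k₄ k₅ : F}

theorem near_lev5_of_five_edges (p b n c : F)
    (h₁ : k₂ - a₅ + k₁ * a₁ = p * b + n * c)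
    (h₂ : k₄ - a₃ - a₁ * k₂ + k₁ * a₁ ^ 2 = -(p * b ^ 2 + n * c ^ 2))
    (h₃ : k₅ - a₂ - k₁ * a₁ ^ 3 = -(p * b ^ 3 + n * c ^ 3))
    (h₄ : k₃ - k₁ ^ 2 * a₁ ^ 3 - a₄ + k₁ * a₂ = p ^ 2 * b ^ 3 - n * p * b ^ 3 + n ^ 2 * c ^ 3) :
    Near (graph e) 5 (lev5 false a₁ a₂ a₃ a₄ a₅) (lev5 true k₁ k₂ k₃ k₄ k₅) := by
  refine .cons (near_right e (p + n + k₁) ..) <| .cons (near_left e (a₁ + b) ..) <|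
    .cons (near_right e (n + k₁) ..) <| .cons (near_left e (a₁ + c) ..) <|
    near_incident ⟨?_, ?_, ?_, ?_⟩ <;> grind

/-- A path through a common ancestor of two points at level four. -/
theorem near_lev5_of_ancestor_left (c σ : F)
    (h₁ : k₄ - a₃ - a₁ * k₂ + k₁ * a₁ ^ 2 = σ * c ^ 2)
    (h₂ : k₅ - a₂ - k₁ * a₁ ^ 3 = σ * c ^ 3)
    (h₃ : k₃ - k₁ ^ 2 * a₁ ^ 3 - a₄ + k₁ * a₂ = σ ^ 2 * c ^ 3) :
    Near (graph e) 5 (lev5 false a₁ a₂ a₃ a₄ a₅) (lev5 true k₁ k₂ k₃ k₄ k₅) := by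
  refine .cons (near_parent5 e ..) <| .cons (near_child4 e _ _ _ _ _ (k₂ + k₁ * a₁ + σ * c)) <|
    .cons (near_right e (k₁ - σ) ..) <| .cons (near_left e (a₁ + c) ..) <|
    near_incident ⟨?_, ?_, ?_, ?_⟩ <;> grind

theorem near_lev5_of_ancestor_right (t m : F)
    (h₁ : k₂ - a₅ + k₁ * a₁ = m * t)
    (h₂ : k₄ - a₃ - a₁ * k₂ + k₁ * a₁ ^ 2 = -(m * t ^ 2))
    (h₃ : k₃ - k₁ ^ 2 * a₁ ^ 3 - a₄ + k₁ * a₂ = m ^ 2 * t ^ 3) :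
    Near (graph e) 5 (lev5 false a₁ a₂ a₃ a₄ a₅) (lev5 true k₁ k₂ k₃ k₄ k₅) := by
  refine .cons (near_right e (m + k₁) ..) <| .cons (near_left e (a₁ + t) ..) <|
    .cons (near_right e k₁ ..) <| .cons (near_parent5 e ..) ?_
  convert near_child4 e _ _ _ _ _ _ using 2 <;> grind

theorem near_lev5_of_ancestor_mid_right (c m : F)
    (h₁ : k₂ - a₅ + k₁ * a₁ = m * c)
    (h₂ : k₄ - a₃ - a₁ * k₂ + k₁ * a₁ ^ 2 = -(m * c ^ 2))
    (h₃ : k₃ - k₁ ^ 2 * a₁ ^ 3 - a₄ + k₁ * a₂ =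
      m * (k₅ - a₂ - k₁ * a₁ ^ 3) - m ^ 2 * c ^ 3) :
    Near (graph e) 5 (lev5 false a₁ a₂ a₃ a₄ a₅) (lev5 true k₁ k₂ k₃ k₄ k₅) := by
  refine .cons (near_right e (m + k₁) ..) <| .cons (near_parent5 e ..) <|
    .cons (near_child4 e _ _ _ _ _ (k₅ - k₁ * (a₁ + c) ^ 3 + (m + k₁) * (a₁ + c) ^ 3)) <|
    .cons (near_left e (a₁ + c) ..) <| near_incident ⟨?_, ?_, ?_, ?_⟩ <;> grind

theorem near_lev5_of_ancestor_mid_left (c m : F)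
    (h₁ : k₄ - a₃ - a₁ * k₂ + k₁ * a₁ ^ 2 = c * (k₂ - a₅ + k₁ * a₁) + m * c ^ 2)
    (h₂ : k₅ - a₂ - k₁ * a₁ ^ 3 = -(m * c ^ 3))
    (h₃ : k₃ - k₁ ^ 2 * a₁ ^ 3 - a₄ + k₁ * a₂ = m ^ 2 * c ^ 3) :
    Near (graph e) 5 (lev5 false a₁ a₂ a₃ a₄ a₅) (lev5 true k₁ k₂ k₃ k₄ k₅) := by
  refine .cons (near_right e (m + k₁) ..) <| .cons (near_left e (a₁ + c) ..) <|
    .cons (near_parent5 e ..) <| .cons (near_child4 e _ _ _ _ _ (k₂ + k₁ * (a₁ + c))) <|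
    near_incident ⟨?_, ?_, ?_, ?_⟩ <;> grind

theorem near_lev5_of_two_ancestors
    (h₁ : k₄ - a₃ - a₁ * k₂ + k₁ * a₁ ^ 2 = 0)
    (h₂ : k₃ - k₁ ^ 2 * a₁ ^ 3 - a₄ + k₁ * a₂ = 0) :
    Near (graph e) 5 (lev5 false a₁ a₂ a₃ a₄ a₅) (lev5 true k₁ k₂ k₃ k₄ k₅) := by
  refine .cons (near_parent5 e ..) <| .cons (near_child4 e _ _ _ _ _ (k₂ + k₁ * a₁)) <|
    .cons (near_right e k₁ ..) <| .cons (near_parent5 e ..) ?_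
  convert near_child4 e _ _ _ _ _ _ using 2 <;> grind

theorem near_lev5_of_ancestor3_left
    (h₁ : k₄ - a₃ - a₁ * k₂ + k₁ * a₁ ^ 2 = 0) (h₂ : k₅ - a₂ - k₁ * a₁ ^ 3 = 0) :
    Near (graph e) 5 (lev5 false a₁ a₂ a₃ a₄ a₅) (lev5 true k₁ k₂ k₃ k₄ k₅) := by
  refine .cons (near_parent5 e ..) <| .cons (near_parent4 e ..) <|
    .cons (near_child3 e _ _ _ _ (k₃ - k₁ ^ 2 * a₁ ^ 3 + k₁ * a₂)) <|
    .cons (near_child4 e _ _ _ _ _ (k₂ + k₁ * a₁)) <|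
    near_incident ⟨?_, ?_, ?_, ?_⟩ <;> grind

theorem near_lev5_of_ancestor3_right
    (h₁ : k₂ - a₅ + k₁ * a₁ = 0) (h₂ : k₃ - k₁ ^ 2 * a₁ ^ 3 - a₄ + k₁ * a₂ = 0) :
    Near (graph e) 5 (lev5 false a₁ a₂ a₃ a₄ a₅) (lev5 true k₁ k₂ k₃ k₄ k₅) := by
  refine .cons (near_right e k₁ ..) <| .cons (near_parent5 e ..) <|
    .cons (near_parent4 e ..) <| .cons (near_child3 e _ _ _ _ k₄) ?_
  convert near_child4 e _ _ _ _ _ _ using 2 <;> grind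

variable (a₁ a₂ a₃ a₄ a₅ k₁ k₂ k₃ k₄ k₅ : F)

theorem near_lev5_lev5 :
    Near (graph e) 5 (lev5 false a₁ a₂ a₃ a₄ a₅) (lev5 true k₁ k₂ k₃ k₄ k₅) := by
  obtain ⟨d, hd⟩ : ∃ d, k₂ - a₅ + k₁ * a₁ = d := ⟨_, rfl⟩
  obtain ⟨f, hf⟩ : ∃ f, k₄ - a₃ - a₁ * k₂ + k₁ * a₁ ^ 2 = f := ⟨_, rfl⟩
  obtain ⟨g, hg⟩ : ∃ g, k₅ - a₂ - k₁ * a₁ ^ 3 = g := ⟨_, rfl⟩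
  obtain ⟨h, hh⟩ : ∃ h, k₃ - k₁ ^ 2 * a₁ ^ 3 - a₄ + k₁ * a₂ = h := ⟨_, rfl⟩
  by_cases hΘ : h + d * f = 0
  · by_cases hf0 : f = 0
    · exact near_lev5_of_two_ancestors e (by grind) (by grind)
    by_cases hd0 : d = 0
    · exact near_lev5_of_ancestor3_right e (by grind) (by grind)
    · apply near_lev5_of_ancestor_right e (-f / d) (-d ^ 2 / f) <;> simp only [hd, hf, hh] <;> clear hd hf hg hh <;> field_simp <;> grind
  obtain ⟨c, hc⟩ : ∃ c, c * (h + d * f) = d * g + f ^ 2 :=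
    ⟨(d * g + f ^ 2) / (h + d * f), div_mul_cancel₀ _ hΘ⟩
  by_cases hX : f + c * d = 0
  · by_cases hc0 : c = 0
    · have hf0 : f = 0 := by grind
      by_cases hg0 : g = 0
      · exact near_lev5_of_ancestor3_left e (by grind) (by grind)
      · apply near_lev5_of_ancestor_mid_right e c (h / g) <;> simp only [hd, hf, hg, hh] <;> clear hd hf hg hh <;> field_simp <;> grind
    · apply near_lev5_of_ancestor_mid_right e c (d / c) <;> simp only [hd, hf, hg, hh] <;> clear hd hf hg hh <;> field_simp <;> grind
  by_cases hY : g = c * f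
  · have hc0 : c ≠ 0 := by grind
    apply near_lev5_of_ancestor_left e c (f / c ^ 2) <;> simp only [hf, hg, hh] <;> clear hd hf hg hh <;> field_simp <;> grind
  by_cases hZ : g + c * f = c ^ 2 * d
  · have hc0 : c ≠ 0 := by grind
    apply near_lev5_of_ancestor_mid_left e c (-g / c ^ 3) <;> simp only [hd, hf, hg, hh] <;> clear hd hf hg hh <;> field_simp <;> grind
  obtain ⟨x, hx⟩ : ∃ x, x = f + c * d := ⟨_, rfl⟩
  obtain ⟨y, hy⟩ : ∃ y, y = g - c * f := ⟨_, rfl⟩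
  obtain ⟨z, hz⟩ : ∃ z, z = g + c * f - c ^ 2 * d := ⟨_, rfl⟩
  have hx0 : x ≠ 0 := by grind
  have hy0 : y ≠ 0 := by grind
  have hz0 : z ≠ 0 := by grind
  apply near_lev5_of_five_edges e (-x ^ 3 / (y * z)) (y / x) ((h + d * f) / z) c <;>
    simp only [hd, hf, hg, hh] <;> clear hd hf hg hh <;> field_simp <;> grind

theorem near_lev4_lev4_opposite :
    Near (graph e) 5 (lev4 false a₁ a₂ a₃ a₄) (lev4 true k₁ k₂ k₃ k₄) := by
  obtain ⟨f, hf⟩ : ∃ f, k₄ - a₃ - a₁ * k₂ + k₁ * a₁ ^ 2 = f := ⟨_, rfl⟩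
  obtain ⟨h, hh⟩ : ∃ h, k₃ - k₁ ^ 2 * a₁ ^ 3 - a₄ + k₁ * a₂ = h := ⟨_, rfl⟩
  by_cases hf0 : f = 0
  · refine .cons (near_parent4 e ..) <|
      .cons (near_child3 e _ _ _ _ (k₃ - k₁ ^ 2 * a₁ ^ 3 + k₁ * a₂)) <|
      .cons (near_child4 e _ _ _ _ _ (k₂ + k₁ * a₁)) <| .cons (near_right e k₁ ..) ?_
    convert near_parent5 e _ _ _ _ _ _ using 2 <;> grind
  by_cases hh0 : h = 0
  · refine .cons (near_child4 e _ _ _ _ _ (k₂ + k₁ * a₁)) <| .cons (near_right e k₁ ..) <|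
      .cons (near_parent5 e ..) <| .cons (near_parent4 e ..) ?_
    convert near_child3 e _ _ _ _ _ using 2 <;> grind
  obtain ⟨t, p, ht, hp⟩ : ∃ t p, f = -(p * t ^ 2) ∧ h = p ^ 2 * t ^ 3 := by
    refine ⟨f ^ 2 / h, -h ^ 2 / f ^ 3, ?_, ?_⟩ <;> field_simp
  refine .cons (near_child4 e _ _ _ _ _ (k₂ + k₁ * a₁ - p * t)) <|
    .cons (near_right e (p + k₁) ..) <| .cons (near_left e (a₁ + t) ..) <|
    .cons (near_right e k₁ ..) ?_
  convert near_parent5 e _ _ _ _ _ _ using 2 <;> grind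

theorem near_lev3_lev5_opposite_left (h₀ : k₅ - a₂ - k₁ * a₁ ^ 3 ≠ 0) :
    Near (graph e) 5 (lev3 false a₁ a₂ a₃) (lev5 true k₁ k₂ k₃ k₄ k₅) := by
  obtain ⟨f, hf⟩ : ∃ f, k₄ - a₃ - a₁ * k₂ + k₁ * a₁ ^ 2 = f := ⟨_, rfl⟩
  obtain ⟨g, hg⟩ : ∃ g, k₅ - a₂ - k₁ * a₁ ^ 3 = g := ⟨_, rfl⟩
  rw [hg] at h₀
  by_cases hf0 : f = 0
  · refine .cons (near_child3 e _ _ _ _ (k₃ - k₁ ^ 2 * a₁ ^ 3 + k₁ * a₂)) <|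
      .cons (near_child4 e _ _ _ _ _ (k₂ + k₁ * a₁)) <| .cons (near_right e k₁ ..) <|
      .cons (near_parent5 e ..) ?_
    convert near_child4 e _ _ _ _ _ _ using 2 <;> grind
  obtain ⟨t, p, ht, hp⟩ : ∃ t p, f = -(p * t ^ 2) ∧ g = -(p * t ^ 3) := by
    refine ⟨g / f, -f ^ 3 / g ^ 2, ?_, ?_⟩ <;> field_simp
  refine .cons (near_child3 e _ _ _ _ (k₃ - k₁ ^ 2 * a₁ ^ 3 + k₁ * a₂ - p ^ 2 * t ^ 3)) <|
    .cons (near_child4 e _ _ _ _ _ (k₂ + k₁ * a₁ - p * t)) <|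
    .cons (near_right e (p + k₁) ..) <| .cons (near_left e (a₁ + t) ..) <|
    near_incident ⟨?_, ?_, ?_, ?_⟩ <;> grind

theorem near_lev3_lev5_opposite_right (h₀ : k₂ - a₅ + k₁ * a₁ ≠ 0) :
    Near (graph e) 5 (lev3 true k₁ k₂ k₃) (lev5 false a₁ a₂ a₃ a₄ a₅) := by
  obtain ⟨d, hd⟩ : ∃ d, k₂ - a₅ + k₁ * a₁ = d := ⟨_, rfl⟩
  obtain ⟨h, hh⟩ : ∃ h, k₃ - k₁ ^ 2 * a₁ ^ 3 - a₄ + k₁ * a₂ = h := ⟨_, rfl⟩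
  rw [hd] at h₀
  by_cases hh0 : h = 0
  · refine .cons (near_child3 e _ _ _ _ (a₃ + a₁ * k₂ - k₁ * a₁ ^ 2)) <|
      .cons (near_child4 e _ _ _ _ _ (k₁ * a₁ ^ 3 + a₂)) <| .cons (near_left e a₁ ..) <|
      .cons (near_parent5 e ..) ?_
    convert near_child4 e _ _ _ _ _ _ using 2 <;> grind
  obtain ⟨t, p, ht, hp⟩ : ∃ t p, d = p * t ∧ h = p ^ 2 * t ^ 3 := by
    refine ⟨h / d ^ 2, d ^ 3 / h, ?_, ?_⟩ <;> field_simp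
  refine .cons (near_child3 e _ _ _ _ (a₃ + a₁ * k₂ - k₁ * a₁ ^ 2 - p * t ^ 2)) <|
    .cons (near_child4 e _ _ _ _ _ (k₁ * a₁ ^ 3 + a₂ - p * t ^ 3)) <|
    .cons (near_left e (a₁ + t) ..) <| .cons (near_right e (p + k₁) ..) <|
    (near_incident ⟨?_, ?_, ?_, ?_⟩).symm <;> grind

theorem near_lev3_lev3_opposite :
    Near (graph e) 5 (lev3 false a₁ a₂ a₃) (lev3 true k₁ k₂ k₃) := by
  refine .cons (near_child3 e _ _ _ _ (k₃ - k₁ ^ 2 * a₁ ^ 3 + k₁ * a₂)) <|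
    .cons (near_child4 e _ _ _ _ _ (k₂ + k₁ * a₁)) <| .cons (near_right e k₁ ..) <|
    .cons (near_parent5 e ..) ?_
  convert near_parent4 e _ _ _ _ _ using 2 <;> grind

variable (s : Bool) (b₁ b₂ b₃ b₄ b₅ : F)

variable {a₁ b₁} in
theorem near_lev3_lev4 (h : a₁ ≠ b₁) :
    Near (graph e) 5 (lev3 s a₁ a₂ a₃) (lev4 s b₁ b₂ b₃ b₄) := by
  obtain ⟨b, rfl⟩ : ∃ b, b₁ = a₁ + b := ⟨b₁ - a₁, by ring⟩
  have hb : b ≠ 0 := by grind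
  cases s
  · obtain ⟨k, hk⟩ : ∃ k, k * b ^ 3 = a₂ - b₂ := ⟨(a₂ - b₂) / b ^ 3, by field_simp⟩
    obtain ⟨c, hc⟩ : ∃ c, c * b = a₃ + k * b ^ 2 - b₃ := ⟨_, div_mul_cancel₀ _ hb⟩
    refine .cons (near_child3 e _ _ _ _ (b₄ - k ^ 2 * b ^ 3)) <|
      .cons (near_child4 e _ _ _ _ _ c) <| .cons (near_right e k ..) <|
      .cons (near_left e (a₁ + b) ..) ?_
    convert near_parent5 e _ _ _ _ _ _ using 2 <;> grind
  · obtain ⟨a, ha⟩ : ∃ a, a * b = a₂ - b₂ := ⟨_, div_mul_cancel₀ _ hb⟩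
    obtain ⟨c, hc⟩ : ∃ c, c * b = b ^ 2 * a ^ 3 + a₃ - b₃ := ⟨_, div_mul_cancel₀ _ hb⟩
    refine .cons (near_child3 e _ _ _ _ (b₄ - b * a ^ 2)) <|
      .cons (near_child4 e _ _ _ _ _ c) <| .cons (near_left e a ..) <|
      .cons (near_right e (a₁ + b) ..) ?_
    convert near_parent5 e _ _ _ _ _ _ using 2 <;> grind

variable {a₁ b₁} in
theorem exists_near_lev5_lev5 (h : a₁ ≠ b₁) :
    ∃ a₃ a₄ a₅, Near (graph e) 2 (lev5 s a₁ a₂ a₃ a₄ a₅) (lev5 s b₁ b₂ b₃ b₄ b₅) := by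
  obtain ⟨b, rfl⟩ : ∃ b, b₁ = a₁ + b := ⟨b₁ - a₁, by ring⟩
  have hb : b ≠ 0 := by grind
  cases s
  · obtain ⟨k, hk⟩ : ∃ k, k * b ^ 3 = a₂ - b₂ := ⟨(a₂ - b₂) / b ^ 3, by field_simp⟩
    obtain ⟨a₃, a₄, a₅, hi⟩ := exists_incident_left a₁ a₂ k (b₅ - k * (a₁ + b))
      (k ^ 2 * (a₁ + b) ^ 3 + b₄ - k * b₂) (k * (a₁ + b) ^ 2 + b₃ + (a₁ + b) * b₅)
      (k * (a₁ + b) ^ 3 + b₂) (by grind)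
    exact ⟨a₃, a₄, a₅, .cons (near_incident hi) (near_right e ..).symm⟩
  · obtain ⟨a, ha⟩ : ∃ a, a * b = a₂ - b₂ := ⟨_, div_mul_cancel₀ _ hb⟩
    obtain ⟨a₃, a₄, a₅, hi⟩ := exists_incident_right a _ _ _ _ a₁ a₂
      (by grind : a₂ = (b₂ + (a₁ + b) * a) - a₁ * a)
    exact ⟨a₃, a₄, a₅, .cons (near_incident hi).symm (near_left e ..).symm⟩

omit [CharP F 3] in
theorem exists_near_lev5_lev4_opposite :
    ∃ a₃ a₄ a₅, Near (graph e) 2 (lev5 s a₁ a₂ a₃ a₄ a₅) (lev4 (!s) b₁ b₂ b₃ b₄) := by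
  cases s
  · obtain ⟨a₃, a₄, a₅, hi⟩ := exists_incident_left a₁ a₂ b₁ b₂ b₃ b₄ _ rfl
    exact ⟨a₃, a₄, a₅, .cons (near_incident hi) (near_parent5 e ..)⟩
  · obtain ⟨a₃, a₄, a₅, hi⟩ := exists_incident_right b₁ b₂ b₃ b₄ (a₂ + a₁ * b₁) a₁ a₂ (by ring)
    exact ⟨a₃, a₄, a₅, .cons (near_incident hi).symm (near_parent5 e ..)⟩

theorem near_lev3_lev5_opposite :
    Near (graph e) 5 (lev3 s a₁ a₂ a₃) (lev5 (!s) b₁ b₂ b₃ b₄ b₅) ∨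
      ∃ c₃ c₄ c₅, Near (graph e) 1 (lev5 s a₁ a₂ c₃ c₄ c₅) (lev5 (!s) b₁ b₂ b₃ b₄ b₅) := by
  cases s
  · by_cases h : b₅ - a₂ - b₁ * a₁ ^ 3 = 0
    · obtain ⟨c₃, c₄, c₅, hi⟩ := exists_incident_left a₁ a₂ b₁ b₂ b₃ b₄ b₅ (by grind)
      exact .inr ⟨c₃, c₄, c₅, near_incident hi⟩
    · exact .inl (near_lev3_lev5_opposite_left e _ _ _ _ _ _ _ _ h)
  · by_cases h : a₂ - b₅ + a₁ * b₁ = 0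
    · obtain ⟨c₃, c₄, c₅, hi⟩ := exists_incident_right b₁ b₂ b₃ b₄ b₅ a₁ a₂ (by grind)
      exact .inr ⟨c₃, c₄, c₅, (near_incident hi).symm⟩
    · exact .inl (near_lev3_lev5_opposite_right e _ _ _ _ _ _ _ _ h)

variable {a₂ b₂} in
theorem near_lev3_lev5_of_ne (h : a₂ ≠ b₂) :
    Near (graph e) 6 (lev3 s a₁ a₂ a₃) (lev5 s a₁ b₂ b₃ b₄ b₅) := by
  cases s
  · exact (near_lev3_lev5_opposite_left e _ _ _ 0 _ _ _ _ (by grind)).trans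
      (near_right e 0 a₁ b₂ b₃ b₄ b₅).symm
  · exact (near_lev3_lev5_opposite_right e 0 _ _ _ _ _ _ _ (by grind)).trans
      (near_left e 0 a₁ b₂ b₃ b₄ b₅).symm

variable {a₂ b₂} in
theorem near_lev4_lev5_of_ne (h : a₂ ≠ b₂) :
    Near (graph e) 5 (lev4 s a₁ a₂ a₃ a₄) (lev5 s a₁ b₂ b₃ b₄ b₅) := by
  obtain ⟨d, rfl⟩ : ∃ d, b₂ = a₂ + d := ⟨b₂ - a₂, by ring⟩
  have hd : d ≠ 0 := by grind
  by_cases h₃ : a₃ = b₃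
  · subst h₃
    cases s
    · obtain ⟨k, hk⟩ : ∃ k, k * d = b₄ - a₄ := ⟨_, div_mul_cancel₀ _ hd⟩
      refine .cons (near_child4 e _ _ _ _ _ b₅) <| .cons (near_right e k ..) <|
        .cons (near_parent5 e ..) <| .cons (near_child4 e _ _ _ _ _ (k * a₁ ^ 3 + (a₂ + d))) <|
        (near_incident ⟨?_, ?_, ?_, ?_⟩).symm <;> grind
    · obtain ⟨a, ha⟩ : ∃ a, a * d = b₄ - a₄ := ⟨_, div_mul_cancel₀ _ hd⟩
      refine .cons (near_child4 e _ _ _ _ _ b₅) <| .cons (near_left e a ..) <|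
        .cons (near_parent5 e ..) <| .cons (near_child4 e _ _ _ _ _ ((a₂ + d) + a₁ * a)) <|
        near_incident ⟨?_, ?_, ?_, ?_⟩ <;> grind
  obtain ⟨f, rfl⟩ : ∃ f, b₃ = a₃ + f := ⟨b₃ - a₃, by ring⟩
  have hf : f ≠ 0 := by grind
  clear h h₃
  cases s
  · obtain ⟨t, p, ht, hp⟩ : ∃ t p, d = -(p * t ^ 3) ∧ f = -(p * t ^ 2) := by
      refine ⟨d / f, -f ^ 3 / d ^ 2, ?_, ?_⟩ <;> field_simp
    obtain ⟨n, hn⟩ : ∃ n, b₄ - a₄ = t ^ 3 * (p ^ 2 - n * p) := by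
      refine ⟨p - (b₄ - a₄) / (p * t ^ 3), ?_⟩
      field_simp
      grind
    refine .cons (near_child4 e _ _ _ _ _ (b₅ - p * t)) <| .cons (near_right e (p + n) ..) <|
      .cons (near_left e (a₁ + t) ..) <| .cons (near_right e n ..) <|
      (near_incident ⟨?_, ?_, ?_, ?_⟩).symm <;> grind
  · obtain ⟨t, m, ht, hm⟩ : ∃ t m, d = m * t ∧ f = m ^ 2 * t ^ 3 := by
      refine ⟨f / d ^ 2, d ^ 3 / f, ?_, ?_⟩ <;> field_simp
    obtain ⟨a, ha⟩ : ∃ a, b₄ - a₄ = m * a * t - m * t ^ 2 := by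
      have hm0 : m ≠ 0 := by grind
      have ht0 : t ≠ 0 := by grind
      refine ⟨(b₄ - a₄ + m * t ^ 2) / (m * t), ?_⟩
      field_simp
      ring
    refine .cons (near_child4 e _ _ _ _ _ (b₅ + m * t ^ 3)) <| .cons (near_left e a ..) <|
      .cons (near_right e (a₁ + m) ..) <| .cons (near_left e (a + t) ..) <|
      near_incident ⟨?_, ?_, ?_, ?_⟩ <;> grind

variable {a₁ b₁} in
theorem near_lev4_lev5_false (h : a₁ ≠ b₁) :
    Near (graph e) 5 (lev4 false a₁ a₂ a₃ a₄) (lev5 false b₁ b₂ b₃ b₄ b₅) := by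
  obtain ⟨b, rfl⟩ : ∃ b, b₁ = a₁ + b := ⟨b₁ - a₁, by ring⟩
  have hb : b ≠ 0 := by grind
  clear h
  obtain ⟨f, hf⟩ : ∃ f, a₃ - b₃ - b * b₅ = f := ⟨_, rfl⟩
  obtain ⟨g, hg⟩ : ∃ g, a₂ - b₂ = g := ⟨_, rfl⟩
  obtain ⟨h, hh⟩ : ∃ h, b₄ - a₄ = h := ⟨_, rfl⟩
  obtain ⟨m, hm⟩ : ∃ m, m * b ^ 2 = f := ⟨f / b ^ 2, by field_simp⟩
  by_cases h₁ : g = b * f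
  · refine .cons (near_parent4 e ..) <|
      .cons (near_child3 e _ _ _ _ (m ^ 2 * b ^ 3 + b₄ - m * b₂ + m * a₂)) <|
      .cons (near_child4 e _ _ _ _ _ (b₅ - m * b)) <| .cons (near_right e m ..) <|
      (near_incident ⟨?_, ?_, ?_, ?_⟩).symm <;> grind
  by_cases h₂ : h * b ^ 2 + f * (b * f + g) = 0
  · refine .cons (near_child4 e _ _ _ _ _ (b₅ - m * b)) <| .cons (near_right e m ..) <|
      .cons (near_parent5 e ..) <| .cons (near_child4 e _ _ _ _ _ (m * (a₁ + b) ^ 3 + b₂)) <|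
      (near_incident ⟨?_, ?_, ?_, ?_⟩).symm <;> grind
  by_cases h₃ : g ^ 2 = h * b ^ 3
  · clear hm
    obtain ⟨m, hm⟩ : ∃ m, m * b ^ 3 = g := ⟨g / b ^ 3, by field_simp⟩
    obtain ⟨c, hc⟩ : ∃ c, c * b = a₃ + m * b ^ 2 - b₃ := ⟨_, div_mul_cancel₀ _ hb⟩
    refine .cons (near_child4 e _ _ _ _ _ c) <| .cons (near_right e m ..) <|
      .cons (near_left e (a₁ + b) ..) <| .cons (near_parent5 e ..) ?_
    convert near_child4 e _ _ _ _ _ _ using 2 <;> grind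
  obtain ⟨p, n, c, hp, hn, hc⟩ : ∃ p n c, g = p * c ^ 3 + n * b ^ 3 ∧
      f = p * c ^ 2 + n * b ^ 2 ∧ h = p ^ 2 * c ^ 3 - n * p * c ^ 3 + n ^ 2 * b ^ 3 := by
    clear hm
    obtain ⟨l, hl⟩ : ∃ l, l = g - b * f := ⟨_, rfl⟩
    obtain ⟨k, hk⟩ : ∃ k, k = h * b ^ 2 + f * (b * f + g) := ⟨_, rfl⟩
    obtain ⟨m, hm⟩ : ∃ m, m = g ^ 2 - h * b ^ 3 := ⟨_, rfl⟩
    have hl0 : l ≠ 0 := by grind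
    have hk0 : k ≠ 0 := by grind
    have hm0 : m ≠ 0 := by grind
    clear hf hg hh h₁ h₂ h₃
    refine ⟨k ^ 3 / (m * l ^ 3), (f - l * k / m) / b ^ 2, l ^ 2 / k, ?_, ?_, ?_⟩ <;>
      field_simp <;> grind
  clear hm h₁ h₂ h₃
  refine .cons (near_child4 e _ _ _ _ _ (b₅ - p * c - n * b)) <|
    .cons (near_right e (p + n) ..) <| .cons (near_left e (a₁ + c) ..) <|
    .cons (near_right e n ..) <| (near_incident ⟨?_, ?_, ?_, ?_⟩).symm <;> grind

variable {a₁ b₁} in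
theorem near_lev4_lev5_true (h : a₁ ≠ b₁) :
    Near (graph e) 5 (lev4 true a₁ a₂ a₃ a₄) (lev5 true b₁ b₂ b₃ b₄ b₅) := by
  obtain ⟨l, rfl⟩ : ∃ l, b₁ = a₁ + l := ⟨b₁ - a₁, by ring⟩
  have hl : l ≠ 0 := by grind
  clear h
  obtain ⟨d, hd⟩ : ∃ d, b₂ - a₂ = d := ⟨_, rfl⟩
  obtain ⟨f, hf⟩ : ∃ f, b₃ - a₃ + l * b₅ = f := ⟨_, rfl⟩
  obtain ⟨g, hg⟩ : ∃ g, b₄ - a₄ = g := ⟨_, rfl⟩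
  obtain ⟨a, ha⟩ : ∃ a, a * l = -d := ⟨_, div_mul_cancel₀ _ hl⟩
  by_cases h₁ : l * g = d ^ 2
  · obtain ⟨c, hc⟩ : ∃ c, c * l = l ^ 2 * a ^ 3 + a₃ - b₃ := ⟨_, div_mul_cancel₀ _ hl⟩
    refine .cons (near_child4 e _ _ _ _ _ c) <| .cons (near_left e a ..) <|
      .cons (near_right e (a₁ + l) ..) <| .cons (near_parent5 e ..) ?_
    convert near_child4 e _ _ _ _ _ _ using 2 <;> grind
  obtain ⟨b, hb⟩ : ∃ b, b * (l * g - d ^ 2) = f - d * g :=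
    ⟨_, div_mul_cancel₀ _ (sub_ne_zero.2 h₁)⟩
  by_cases h₂ : d + l * b = 0
  · refine .cons (near_parent4 e ..) <| .cons (near_child3 e _ _ _ _ (b₄ - l * a ^ 2)) <|
      .cons (near_child4 e _ _ _ _ _ (b₅ - l * a ^ 3)) <| .cons (near_left e a ..) <|
      near_incident ⟨?_, ?_, ?_, ?_⟩ <;> grind
  clear ha
  by_cases h₃ : g - d * b + l * b ^ 2 = 0
  · refine .cons (near_child4 e _ _ _ _ _ (b₅ - l * b ^ 3)) <| .cons (near_left e b ..) <|
      .cons (near_parent5 e ..) <| .cons (near_child4 e _ _ _ _ _ (b₂ + (a₁ + l) * b)) <|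
      near_incident ⟨?_, ?_, ?_, ?_⟩ <;> grind
  obtain ⟨m, t, hm₁, hm₂, hm₃⟩ : ∃ m t, d = m * t - l * b ∧
      g = m * t * b + m * t ^ 2 + l * b ^ 2 ∧ f = m ^ 2 * t ^ 3 - l ^ 2 * b ^ 3 := by
    obtain ⟨y, hy⟩ : ∃ y, y = d + l * b := ⟨_, rfl⟩
    obtain ⟨z, hz⟩ : ∃ z, z = g - d * b + l * b ^ 2 := ⟨_, rfl⟩
    have hy0 : y ≠ 0 := by grind
    have hz0 : z ≠ 0 := by grind
    clear hd hf hg h₂ h₃ h₁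
    refine ⟨y ^ 2 / z, z / y, ?_, ?_, ?_⟩ <;> field_simp <;> grind
  clear h₁ h₂ h₃ hb
  refine .cons (near_child4 e _ _ _ _ _ (b₅ - l * b ^ 3 + m * t ^ 3)) <|
    .cons (near_left e (b - t) ..) <| .cons (near_right e (a₁ + m) ..) <|
    .cons (near_left e b ..) <| near_incident ⟨?_, ?_, ?_, ?_⟩ <;> grind

variable {a₁ b₁} in
theorem near_lev4_lev5 (h : a₁ ≠ b₁) :
    Near (graph e) 5 (lev4 s a₁ a₂ a₃ a₄) (lev5 s b₁ b₂ b₃ b₄ b₅) := by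
  cases s
  · exact near_lev4_lev5_false e _ _ _ _ _ _ _ h
  · exact near_lev4_lev5_true e _ _ _ _ _ _ _ h

omit [CharP F 3] in
theorem near_lev3_lev3_of_fst_eq :
    Near (graph e) 5 (lev3 s a₁ a₂ a₃) (lev3 s a₁ b₂ b₃) :=
  .cons (near_attach e ..).symm <| (near_core_of_fst_eq e _ _ _ _ _ _).trans (near_attach e ..)

omit [CharP F 3] in
theorem near_lev3_lev3_of_eq : Near (graph e) 3 (lev3 s a₁ a₂ a₃) (lev3 s a₁ a₂ b₃) :=
  .cons (near_attach e ..).symm (near_core_lev3 e ..)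

variable (s' : Bool)

theorem near_six_lev3_lev3 : Near (graph e) 6 (lev3 s a₁ a₂ a₃) (lev3 s' b₁ b₂ b₃) := by
  by_cases hs : s = s'
  · subst hs
    by_cases h : a₁ = b₁
    · subst h; exact (near_lev3_lev3_of_fst_eq e ..).mono (by norm_num)
    · exact (near_lev3_lev4 e _ _ s _ _ 0 h).trans (near_parent4 e ..)
  · obtain rfl : s' = !s := by cases s <;> cases s' <;> simp at hs ⊢
    cases s
    · exact (near_lev3_lev3_opposite e ..).mono (by norm_num)
    · exact (near_lev3_lev3_opposite e ..).symm.mono (by norm_num)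

theorem near_six_lev3_lev4 : Near (graph e) 6 (lev3 s a₁ a₂ a₃) (lev4 s' b₁ b₂ b₃ b₄) := by
  by_cases hs : s = s'
  · subst hs
    by_cases h : a₁ = b₁
    · subst h; exact (near_lev3_lev3_of_fst_eq e ..).trans (near_child3 e ..)
    · exact (near_lev3_lev4 e _ _ s _ _ _ h).mono (by norm_num)
  · obtain rfl : s' = !s := by cases s <;> cases s' <;> simp at hs ⊢
    cases s
    · exact .cons (near_child3 e _ _ _ _ 0) (near_lev4_lev4_opposite e ..)
    · exact .cons (near_child3 e _ _ _ _ 0) (near_lev4_lev4_opposite e ..).symm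

theorem near_six_lev3_lev5 : Near (graph e) 6 (lev3 s a₁ a₂ a₃) (lev5 s' b₁ b₂ b₃ b₄ b₅) := by
  by_cases hs : s = s'
  · subst hs
    by_cases h : a₁ = b₁
    · subst h
      by_cases h₂ : a₂ = b₂
      · subst h₂
        exact .mono (((near_lev3_lev3_of_eq e ..).trans (near_child3 e ..)).trans
          (near_child4 e ..)) (by norm_num)
      · exact near_lev3_lev5_of_ne e _ _ _ _ _ _ h₂
    · exact (near_lev3_lev4 e _ _ s _ _ _ h).trans (near_child4 e ..)
  · obtain rfl : s' = !s := by cases s <;> cases s' <;> simp at hs ⊢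
    rcases near_lev3_lev5_opposite e a₁ a₂ a₃ s b₁ b₂ b₃ b₄ b₅ with h | ⟨c₃, c₄, c₅, h⟩
    · exact h.mono (by norm_num)
    · exact (near_lev3_lev3_of_eq e ..).trans <| .cons (near_child3 e _ _ _ _ _) <|
        .cons (near_child4 e _ _ _ _ _ _) h

theorem near_six_lev4_lev5 :
    Near (graph e) 6 (lev4 s a₁ a₂ a₃ a₄) (lev5 s' b₁ b₂ b₃ b₄ b₅) := by
  by_cases hs : s = s'
  · subst hs
    by_cases h : a₁ = b₁
    · subst h
      by_cases h₂ : a₂ = b₂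
      · subst h₂
        exact .cons (near_parent4 e ..) <| ((near_lev3_lev3_of_eq e ..).trans
          (near_child3 e ..)).trans (near_child4 e ..)
      · exact (near_lev4_lev5_of_ne e _ _ _ _ _ _ _ h₂).mono (by norm_num)
    · exact (near_lev4_lev5 e _ _ _ s _ _ _ _ h).mono (by norm_num)
  · obtain rfl : s' = !s := by cases s <;> cases s' <;> simp at hs ⊢
    cases s
    · exact .cons (near_child4 e _ _ _ _ _ 0) (near_lev5_lev5 e ..)
    · exact .cons (near_child4 e _ _ _ _ _ 0) (near_lev5_lev5 e ..).symm

theorem near_six_lev4_lev4 : Near (graph e) 6 (lev4 s a₁ a₂ a₃ a₄) (lev4 s' b₁ b₂ b₃ b₄) := by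
  by_cases hs : s = s'
  · subst hs
    by_cases h : a₁ = b₁
    · subst h
      by_cases h₂ : a₂ = b₂
      · subst h₂
        exact .mono (.cons (near_parent4 e ..) <| (near_lev3_lev3_of_eq e ..).trans
          (near_child3 e ..)) (by norm_num)
      · exact (near_lev4_lev5_of_ne e _ _ _ _ _ _ 0 h₂).trans (near_parent5 e ..)
    · exact (near_lev4_lev5 e _ _ _ s _ _ _ 0 h).trans (near_parent5 e ..)
  · obtain rfl : s' = !s := by cases s <;> cases s' <;> simp at hs ⊢
    cases s
    · exact (near_lev4_lev4_opposite e ..).mono (by norm_num)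
    · exact (near_lev4_lev4_opposite e ..).symm.mono (by norm_num)

theorem near_six_lev5_lev5 :
    Near (graph e) 6 (lev5 s a₁ a₂ a₃ a₄ a₅) (lev5 s' b₁ b₂ b₃ b₄ b₅) := by
  cases s <;> cases s'
  · exact (near_lev5_lev5 e ..).trans (near_right e 0 b₁ b₂ b₃ b₄ b₅).symm
  · exact (near_lev5_lev5 e ..).mono (by norm_num)
  · exact (near_lev5_lev5 e ..).symm.mono (by norm_num)
  · exact .cons (near_left e 0 ..) (near_lev5_lev5 e ..)

omit [CharP F 3] in
theorem near_six_core_lev3 (x c) : Near (graph e) 6 (core x c) (lev3 s a₁ a₂ a₃) :=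
  (near_core e x _ c _).trans (near_attach e ..)

theorem near_six_core_lev4 (c) :
    Near (graph e) 6 (core (s, e a₁, e a₂) c) (lev4 s' b₁ b₂ b₃ b₄) := by
  by_cases hs : s = s'
  · subst hs
    by_cases h : a₁ = b₁
    · subst h
      exact .mono (((near_core_of_fst_eq e _ _ _ _ _ _).trans (near_attach e ..)).trans
        (near_child3 e ..)) (by norm_num)
    · obtain ⟨a₃, h₃⟩ := exists_near_lev3 e s a₁ a₂ c
      exact h₃.cons (near_lev3_lev4 e _ _ s _ _ _ h)
  · obtain rfl : s' = !s := by cases s <;> cases s' <;> simp at hs ⊢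
    obtain ⟨a₃, a₄, a₅, h⟩ := exists_near_lev5_lev4_opposite e a₁ a₂ s b₁ b₂ b₃ b₄
    exact (((near_core_lev3 e ..).trans (near_child3 e ..)).trans (near_child4 e ..)).trans h

theorem near_six_core_lev5 (c) :
    Near (graph e) 6 (core (s, e a₁, e a₂) c) (lev5 s' b₁ b₂ b₃ b₄ b₅) := by
  by_cases hs : s = s'
  · subst hs
    by_cases h : a₁ = b₁
    · subst h
      exact (((near_core_of_fst_eq e _ _ _ _ _ _).trans (near_attach e ..)).trans
        (near_child3 e ..)).trans (near_child4 e ..)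
    · obtain ⟨a₃, a₄, a₅, h⟩ := exists_near_lev5_lev5 e a₂ s b₂ b₃ b₄ b₅ h
      exact (((near_core_lev3 e ..).trans (near_child3 e ..)).trans (near_child4 e ..)).trans h
  · obtain rfl : s' = !s := by cases s <;> cases s' <;> simp at hs ⊢
    obtain ⟨a₃, h₃⟩ := exists_near_lev3 e s a₁ a₂ c
    rcases near_lev3_lev5_opposite e a₁ a₂ a₃ s b₁ b₂ b₃ b₄ b₅ with h | ⟨c₃, c₄, c₅, h⟩
    · exact h₃.cons h
    · exact .mono ((((near_core_lev3 e ..).trans (near_child3 e ..)).trans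
        (near_child4 e ..)).trans h) (by norm_num)

theorem near_six (u v : Vertex F) : Near (graph e) 6 u v := by
  have core_outer : ∀ x c (w : Vertex F), Near (graph e) 6 (core x c) w := by
    rintro ⟨s, i, j⟩ c w
    obtain ⟨a₁, rfl⟩ := e.surjective i
    obtain ⟨a₂, rfl⟩ := e.surjective j
    cases w
    · exact (near_core e ..).mono (by norm_num)
    · exact near_six_core_lev3 e ..
    · exact near_six_core_lev4 e ..
    · exact near_six_core_lev5 e ..
  cases u <;> cases v
  all_goals first
    | exact core_outer _ _ _
    | exact (core_outer _ _ _).symm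
    | exact near_six_lev3_lev3 e ..
    | exact near_six_lev3_lev4 e ..
    | exact (near_six_lev3_lev4 e ..).symm
    | exact near_six_lev3_lev5 e ..
    | exact (near_six_lev3_lev5 e ..).symm
    | exact near_six_lev4_lev4 e ..
    | exact near_six_lev4_lev5 e ..
    | exact (near_six_lev4_lev5 e ..).symm
    | exact near_six_lev5_lev5 e ..

end Coordinates

end Paths

section Degree

variable {F : Type} [Field F] (e : F ≃ Fin 9)

omit [Field F] in
theorem ncard_le_ten {V : Type} {S : Set V} (p : V) (f : F → V)
    (h : ∀ v ∈ S, v = p ∨ ∃ a, v = f a) (e : F ≃ Fin 9) : S.ncard ≤ 10 := by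
  classical
  have hS : S ⊆ ↑(insert p (Finset.univ.image fun i ↦ f (e.symm i))) := by
    intro v hv
    rcases h v hv with h | ⟨a, h⟩
    · simp [h]
    · simpa [h] using .inr ⟨e a, by simp⟩
  calc S.ncard ≤ _ := Set.ncard_le_ncard hS (Finset.finite_toSet _)
    _ = _ := Set.ncard_coe_finset _
    _ ≤ _ + 1 := Finset.card_insert_le _ _
    _ ≤ 9 + 1 := by gcongr; exact Finset.card_image_le.trans (by simp)

/-- The outer neighbours of the core vertices over `x`, indexed by slots. -/
def slotNeighbor (x : Super) (t : Fin 30) : Vertex F :=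
  if t.val < 9 then lev3 x.1 (e.symm x.2.1) (e.symm x.2.2) (e.symm (Fin.ofNat 9 t))
  else port F (next x (Fin.ofNat 21 (t - 9))) (9 + rev (Fin.ofNat 21 (t - 9)))

omit [Field F] in
theorem slotNeighbor_link (x : Super) (t : Fin 21) :
    slotNeighbor e x ⟨9 + t, by omega⟩ = port F (next x t) (9 + rev t) := by
  have h : Fin.ofNat 21 (9 + (t : ℕ) - 9) = t := by ext; simp
  simp [slotNeighbor]

omit [Field F] in
theorem slotNeighbor_attach (s : Bool) (a₁ a₂ a₃ : F) :
    slotNeighbor e (s, e a₁, e a₂) ⟨e a₃, by omega⟩ = lev3 s a₁ a₂ a₃ := by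
  simp [slotNeighbor]

theorem cliqueSize_eq (x : Super) : cliqueSize x = 5 ∨ cliqueSize x = 6 := by
  unfold cliqueSize; split_ifs <;> simp

theorem card_slots (h : ℕ) (hh : h = 5 ∨ h = 6) (c : ℕ) (hc : c < h) :
    h - 1 + (Finset.univ.filter fun t : Fin 30 ↦ t.val % h = c).card ≤ 10 := by
  rcases hh with rfl | rfl <;> interval_cases c <;> decide

theorem neighbor_core {x c v} (h : (graph e).Adj (core x c) v) :
    (∃ c', c' ≠ c ∧ v = core x c') ∨
      ∃ t : Fin 30, t.val % cliqueSize x = c ∧ v = slotNeighbor e x t := by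
  obtain ⟨hne, h | h⟩ := (SimpleGraph.fromRel_adj _ _ _).1 h
  · cases h with
    | clique _ _ c' => exact .inl ⟨c', by rintro rfl; exact hne rfl, rfl⟩
    | link _ t => exact .inr ⟨⟨9 + t, by omega⟩, rfl, (slotNeighbor_link e x t).symm⟩
    | attach s a₁ a₂ a₃ =>
      exact .inr ⟨⟨e a₃, by omega⟩, rfl, (slotNeighbor_attach e s a₁ a₂ a₃).symm⟩
  · generalize hu : core x c = u at h
    cases h with
    | clique _ c' _ =>
      cases hu
      exact .inl ⟨c', by rintro rfl; exact hne rfl, rfl⟩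
    | link y t =>
      cases hu
      refine .inr ⟨⟨9 + rev t, by omega⟩, rfl, ?_⟩
      rw [slotNeighbor_link, next_next_rev, rev_rev]
    | _ => cases hu

theorem ncard_neighborSet_core (x c) : ((graph e).neighborSet (core x c)).ncard ≤ 10 := by
  classical
  have hS : (graph e).neighborSet (core x c) ⊆
      ↑((Finset.univ.erase c).image (core x) ∪
        (Finset.univ.filter fun t : Fin 30 ↦ t.val % cliqueSize x = c).image
          (slotNeighbor e x)) := by
    intro v hv
    rcases neighbor_core e hv with ⟨c', h, rfl⟩ | ⟨t, h, rfl⟩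
    · exact Finset.mem_coe.2 (Finset.mem_union_left _
        (Finset.mem_image_of_mem _ (by simpa using h)))
    · exact Finset.mem_coe.2 (Finset.mem_union_right _
        (Finset.mem_image_of_mem _ (by simpa using h)))
  calc _ ≤ _ := Set.ncard_le_ncard hS (Finset.finite_toSet _)
    _ = _ := Set.ncard_coe_finset _
    _ ≤ _ + _ := Finset.card_union_le _ _
    _ ≤ (cliqueSize x - 1) + _ := by
      gcongr
      · exact Finset.card_image_le.trans (by simp)
      · exact Finset.card_image_le
    _ ≤ 10 := card_slots _ (cliqueSize_eq x) c c.2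

theorem ncard_neighborSet (u : Vertex F) : ((graph e).neighborSet u).ncard ≤ 10 := by
  cases u with
  | core x c => exact ncard_neighborSet_core e x c
  | lev3 s a₁ a₂ a₃ =>
    refine ncard_le_ten (port F (s, e a₁, e a₂) (e a₃)) (lev4 s a₁ a₂ a₃) (fun v hv ↦ ?_) e
    obtain ⟨-, h | h⟩ := (SimpleGraph.fromRel_adj _ _ _).1 hv
    · cases h; exact .inr ⟨_, rfl⟩
    · cases h; exact .inl rfl
  | lev4 s a₁ a₂ a₃ a₄ =>
    refine ncard_le_ten (lev3 s a₁ a₂ a₃) (lev5 s a₁ a₂ a₃ a₄) (fun v hv ↦ ?_) e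
    obtain ⟨-, h | h⟩ := (SimpleGraph.fromRel_adj _ _ _).1 hv
    · cases h; exact .inr ⟨_, rfl⟩
    · cases h; exact .inl rfl
  | lev5 s a₁ a₂ a₃ a₄ a₅ =>
    cases s
    · refine ncard_le_ten (lev4 false a₁ a₂ a₃ a₄) (fun k₁ ↦ lev5 true k₁ (a₅ - k₁ * a₁)
        (k₁ ^ 2 * a₁ ^ 3 + a₄ - k₁ * a₂) (k₁ * a₁ ^ 2 + a₃ + a₁ * a₅) (k₁ * a₁ ^ 3 + a₂))
        (fun v hv ↦ ?_) e
      obtain ⟨-, h | h⟩ := (SimpleGraph.fromRel_adj _ _ _).1 hv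
      · cases h with
        | incident _ _ _ _ _ k₁ _ _ _ _ h =>
          obtain ⟨rfl, rfl, rfl, rfl⟩ := h
          exact .inr ⟨k₁, rfl⟩
      · cases h; exact .inl rfl
    · refine ncard_le_ten (lev4 true a₁ a₂ a₃ a₄) (fun b ↦ lev5 false b (a₅ - a₁ * b ^ 3)
        (a₄ - a₁ * b ^ 2 - b * (a₂ + a₁ * b))
        (a₃ - a₁ ^ 2 * b ^ 3 + a₁ * (a₅ - a₁ * b ^ 3)) (a₂ + a₁ * b)) (fun v hv ↦ ?_) e
      obtain ⟨-, h | h⟩ := (SimpleGraph.fromRel_adj _ _ _).1 hv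
      · cases h
      · cases h with
        | child4 => exact .inl rfl
        | incident b _ _ _ _ _ _ _ _ _ h =>
          obtain ⟨rfl, rfl, rfl, rfl⟩ := h
          refine .inr ⟨b, ?_⟩
          congr 1 <;> ring

/-- The vertices as a disjoint union. -/
def vertexEquiv : Vertex F ≃ (Σ x : Super, Fin (cliqueSize x)) ⊕ (Bool × F × F × F) ⊕
    (Bool × F × F × F × F) ⊕ (Bool × F × F × F × F × F) where
  toFun
    | core x c => .inl ⟨x, c⟩
    | lev3 s a₁ a₂ a₃ => .inr (.inl (s, a₁, a₂, a₃))
    | lev4 s a₁ a₂ a₃ a₄ => .inr (.inr (.inl (s, a₁, a₂, a₃, a₄)))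
    | lev5 s a₁ a₂ a₃ a₄ a₅ => .inr (.inr (.inr (s, a₁, a₂, a₃, a₄, a₅)))
  invFun
    | .inl ⟨x, c⟩ => core x c
    | .inr (.inl (s, a₁, a₂, a₃)) => lev3 s a₁ a₂ a₃
    | .inr (.inr (.inl (s, a₁, a₂, a₃, a₄))) => lev4 s a₁ a₂ a₃ a₄
    | .inr (.inr (.inr (s, a₁, a₂, a₃, a₄, a₅))) => lev5 s a₁ a₂ a₃ a₄ a₅
  left_inv v := by cases v <;> rfl
  right_inv v := by rcases v with _ | _ | _ | _ <;> rfl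

theorem sum_cliqueSize : ∑ x : Super, cliqueSize x = 822 := by
  decide +kernel

omit [Field F] in
include e in
theorem card_vertex : Nat.card (Vertex F) = 133500 := by
  have : Finite F := .of_equiv _ e.symm
  have hF : Nat.card F = 9 := by simp [Nat.card_congr e]
  have hcore : Nat.card (Σ x : Super, Fin (cliqueSize x)) = 822 := by
    rw [Nat.card_eq_fintype_card, Fintype.card_sigma]
    simpa using sum_cliqueSize
  rw [Nat.card_congr (vertexEquiv (F := F)), Nat.card_sum, Nat.card_sum, Nat.card_sum, hcore]
  simp [Nat.card_prod, hF]

end Degree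

theorem diam_le_of_near {V : Type} {G : SimpleGraph V} {n : ℕ} (h : ∀ u v, Near G n u v) :
    G.diam ≤ n := by
  refine ENat.toNat_le_of_le_natCast (SimpleGraph.ediam_le_of_edist_le fun u v ↦ ?_)
  obtain ⟨p, hp⟩ := h u v
  exact p.edist_le.trans (by exact_mod_cast hp)

theorem exists_graph_fin {V : Type} (G : SimpleGraph V) {n d k : ℕ} (hn : n ≠ 0)
    (hV : Nat.card V = n) (hd : ∀ v, (G.neighborSet v).ncard ≤ d)
    (hk : ∀ u v, Near G k u v) :
    ∃ G' : SimpleGraph (Fin n), G'.Connected ∧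
      (∀ v : Fin n, (G'.neighborSet v).ncard ≤ d) ∧ G'.diam ≤ k := by
  have : Finite V := Nat.finite_of_card_ne_zero (hV ▸ hn)
  let φ : Fin n ≃ V := (Finite.equivFinOfCardEq hV).symm
  let ψ : G.comap φ ≃g G := SimpleGraph.Iso.comap φ G
  have hnear (u v : Fin n) : Near (G.comap φ) k u v := by
    obtain ⟨p, hp⟩ := hk (ψ u) (ψ v)
    refine ⟨(p.map ψ.symm.toHom).copy (ψ.symm_apply_apply u) (ψ.symm_apply_apply v), ?_⟩
    simpa using hp
  have : Nonempty (Fin n) := ⟨⟨0, Nat.pos_of_ne_zero hn⟩⟩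
  refine ⟨G.comap φ, ⟨fun u v ↦ ?_⟩, fun v ↦ ?_, diam_le_of_near hnear⟩
  · obtain ⟨p, -⟩ := hnear u v
    exact ⟨p⟩
  · have : Finite (G.neighborSet (φ v)) := Subtype.finite
    refine (Set.ncard_le_ncard_of_injOn φ (t := G.neighborSet (φ v)) (fun w hw ↦ hw)
      φ.injective.injOn (Set.toFinite _)).trans (hd _)

end ModifiedHexagon

/-- There exists a connected finite simple graph with exactly 133500 vertices,
maximum degree at most 10, and diameter at most 6. -/
theorem exists_connected_graph_card_133500_maxDegree_le_10_diam_le_6 :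
    ∃ G : SimpleGraph (Fin 133500), G.Connected ∧
      (∀ v : Fin 133500, (G.neighborSet v).ncard ≤ 10) ∧ G.diam ≤ 6 := by
  have : Fact (Nat.Prime 3) := ⟨Nat.prime_three⟩
  have hcard : Nat.card (GaloisField 3 2) = 9 := by
    rw [GaloisField.card 3 2 two_ne_zero]; norm_num
  have : Finite (GaloisField 3 2) := Nat.finite_of_card_ne_zero (by rw [hcard]; norm_num)
  let e : GaloisField 3 2 ≃ Fin 9 := Finite.equivFinOfCardEq hcard
  exact ModifiedHexagon.exists_graph_fin (ModifiedHexagon.graph e) (by norm_num)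
    (ModifiedHexagon.card_vertex e) (ModifiedHexagon.ncard_neighborSet e)
    (ModifiedHexagon.near_six e)
end
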